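/- arXiv:1001.0811 — 3 statements merged into one kernel-verified Lean document; each statement's English description precedes it below -/
import Mathlib

section
/- Let X be a matrix over a field K with cycle type f^λ for a monic irreducible polynomial f of degree d, and let F ∈ K[x] be any polynomial. Then F(X) has cycle type g^μ for a single monic irreducible polynomial g whose degree e divides d, and the partition μ satisfies e|μ| = d|λ| and dλ dominates eμ. -/
open Polynomial Matrix

/-- Two square matrices over a commutative ring are *similar* if they are
conjugate by an invertible matrix. -/
def SimilarMat {m : Type*} [Fintype m] [DecidableEq m] {K : Type*} [CommRing K]
    (A B : Matrix m m K) : Prop :=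
  ∃ P : (Matrix m m K)ˣ, B = (↑P : Matrix m m K) * A * (↑P⁻¹ : Matrix m m K)

/-- `M` has (primary) cycle type `f ^ lam`: it is similar to a direct sum of
cyclic blocks, one for each part `h` of `lam`, each block having both
characteristic polynomial and minimal polynomial equal to `f ^ h`. -/
def HasPrimaryCycleType {K : Type*} [Field K] {n m : ℕ}
    (M : Matrix (Fin n) (Fin n) K) (f : Polynomial K) (lam : Nat.Partition m) : Prop :=
  ∃ L : List ℕ, (↑L : Multiset ℕ) = lam.parts ∧
    ∃ B : (i : Fin L.length) →
        Matrix (Fin (f.natDegree * L.get i)) (Fin (f.natDegree * L.get i)) K,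
      (∀ i, (B i).charpoly = f ^ L.get i ∧ minpoly K (B i) = f ^ L.get i) ∧
      ∃ e : ((i : Fin L.length) × Fin (f.natDegree * L.get i)) ≃ Fin n,
        SimilarMat (Matrix.reindex e e (Matrix.blockDiagonal' B)) M

/-- The sum of the `j` largest elements of a multiset of naturals. -/
def takeSum (s : Multiset ℕ) (j : ℕ) : ℕ := (((s.sort (· ≤ ·)).reverse).take j).sum

/-- Dominance order: `s` dominates `t` if for every `j` the sum of the `j`
largest elements of `s` is at least the sum of the `j` largest elements of `t`. -/
def MDominates (s t : Multiset ℕ) : Prop := ∀ j : ℕ, takeSum t j ≤ takeSum s j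

section TakeSum

theorem sum_le_mul_add_sum_tsub (l : List ℕ) (j k : ℕ) :
    (l.take j).sum ≤ j * k + (l.map (· - k)).sum := by
  induction l generalizing j with
  | nil => simp
  | cons a t ih =>
    cases j with
    | zero => simp
    | succ j =>
      have := ih j
      simp only [List.take_succ_cons, List.sum_cons, List.map_cons, add_mul, one_mul]
      omega

theorem exists_mul_add_sum_tsub_le (l : List ℕ) (hl : l.Pairwise (· ≥ ·)) (j : ℕ) :
    ∃ k, (∀ a, (∀ x ∈ l, x ≤ a) → k ≤ a) ∧
      j * k + (l.map (· - k)).sum ≤ (l.take j).sum := by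
  induction l generalizing j with
  | nil => exact ⟨0, by simp⟩
  | cons a t ih =>
    obtain ⟨ha, ht⟩ := List.pairwise_cons.1 hl
    cases j with
    | zero =>
      refine ⟨a, fun b hb => hb a (by simp), ?_⟩
      have : ((a :: t).map (· - a)).sum = 0 := by
        rw [List.sum_eq_zero_iff]
        simpa [Nat.sub_eq_zero_iff_le] using ha
      rw [this]
      simp
    | succ j =>
      obtain ⟨k, hk, h⟩ := ih ht j
      refine ⟨k, fun b hb => hk b fun x hx => hb x (by simp [hx]), ?_⟩
      have := hk a ha
      simp only [List.take_succ_cons, List.sum_cons, List.map_cons, add_mul, one_mul]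
      omega

theorem MDominates.of_sum_tsub_le {s t : Multiset ℕ}
    (h : ∀ k, (t.map (· - k)).sum ≤ (s.map (· - k)).sum) : MDominates s t := by
  have sum_map (u : Multiset ℕ) (k : ℕ) :
      ((u.sort (· ≤ ·)).reverse.map (· - k)).sum = (u.map (· - k)).sum := by
    conv_rhs => rw [← Multiset.sort_eq u (· ≤ ·)]
    rw [Multiset.map_coe, Multiset.sum_coe, List.map_reverse, List.sum_reverse]
  intro j
  obtain ⟨k, -, hk⟩ := exists_mul_add_sum_tsub_le (s.sort (· ≤ ·)).reverse
    (List.pairwise_reverse.2 (Multiset.pairwise_sort s (· ≤ ·))) j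
  have ht := sum_le_mul_add_sum_tsub (t.sort (· ≤ ·)).reverse j k
  rw [sum_map] at hk ht
  exact ht.trans ((Nat.add_le_add_left (h k) _).trans hk)

end TakeSum

section Rank

variable {K : Type*} [Field K]

theorem Matrix.rank_blockDiagonal' {o : Type*} [Fintype o] [DecidableEq o] {m : o → Type*}
    [∀ i, Fintype (m i)] (A : ∀ i, Matrix (m i) (m i) K) :
    (Matrix.blockDiagonal' A).rank = ∑ i, (A i).rank := by
  classical
  have mulVec_eq (x : (Σ i, m i) → K) (i : o) (s : m i) :
      (Matrix.blockDiagonal' A *ᵥ x) ⟨i, s⟩ = (A i *ᵥ fun t => x ⟨i, t⟩) s := by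
    simp only [Matrix.mulVec, dotProduct, Fintype.sum_sigma]
    rw [Finset.sum_eq_single i]
    · simp [Matrix.blockDiagonal'_apply_eq]
    · intro b _ hb
      simp [Matrix.blockDiagonal'_apply_ne A _ _ hb.symm]
    · simp
  let T : (∀ i, LinearMap.range (A i).mulVecLin) →ₗ[K] ((Σ i, m i) → K) :=
    { toFun := fun y p => (y p.1).1 p.2
      map_add' := fun _ _ => rfl
      map_smul' := fun _ _ => rfl }
  have hT : Function.Injective T := by
    intro y z hyz
    funext i
    ext s
    exact congrFun hyz ⟨i, s⟩
  have hrange : LinearMap.range T = LinearMap.range (Matrix.blockDiagonal' A).mulVecLin := by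
    ext v
    constructor
    · rintro ⟨y, rfl⟩
      choose x hx using fun i => (y i).2
      refine ⟨fun p => x p.1 p.2, ?_⟩
      ext ⟨i, s⟩
      rw [Matrix.mulVecLin_apply, mulVec_eq]
      exact congrFun (hx i) s
    · rintro ⟨x, rfl⟩
      refine ⟨fun i => ⟨A i *ᵥ fun t => x ⟨i, t⟩, ⟨_, rfl⟩⟩, ?_⟩
      ext ⟨i, s⟩
      rw [Matrix.mulVecLin_apply, mulVec_eq]
      rfl
  rw [Matrix.rank, ← hrange, LinearMap.finrank_range_of_inj hT, Module.finrank_pi_fintype]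
  rfl

theorem Matrix.eq_zero_of_rank_eq_zero {m n : Type*} [Fintype m] [Fintype n] {A : Matrix m n K}
    (hA : A.rank = 0) : A = 0 := by
  classical
  rw [Matrix.rank, Submodule.finrank_eq_zero, LinearMap.range_eq_bot] at hA
  exact Matrix.toLin'.injective (hA.trans (map_zero _).symm)

theorem Polynomial.aeval_blockDiagonal' {o : Type*} [Fintype o] [DecidableEq o] {m : o → Type*}
    [∀ i, Fintype (m i)] [∀ i, DecidableEq (m i)] (A : ∀ i, Matrix (m i) (m i) K) (p : K[X]) :
    aeval (Matrix.blockDiagonal' A) p = Matrix.blockDiagonal' fun i => aeval (A i) p := by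
  let φ : (∀ i, Matrix (m i) (m i) K) →ₐ[K] Matrix (Σ i, m i) (Σ i, m i) K :=
    { Matrix.blockDiagonal'RingHom m K with
      commutes' := fun r => by
        change Matrix.blockDiagonal' (algebraMap K (∀ i, Matrix (m i) (m i) K) r) = _
        have h : algebraMap K (∀ i, Matrix (m i) (m i) K) r = r • 1 :=
          Algebra.algebraMap_eq_smul_one r
        rw [h, Matrix.blockDiagonal'_smul, Matrix.blockDiagonal'_one,
          Algebra.algebraMap_eq_smul_one] }
  have h1 : aeval (φ A) p = φ (aeval A p) := aeval_algHom_apply φ A p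
  have h2 : aeval A p = fun i => aeval (A i) p := by
    funext i
    exact (aeval_algHom_apply (Pi.evalAlgHom K (fun i => Matrix (m i) (m i) K) i) A p).symm
  rw [h2] at h1
  exact h1

theorem SimilarMat.rank_aeval {m : Type*} [Fintype m] [DecidableEq m] {A B : Matrix m m K}
    (h : SimilarMat A B) (p : K[X]) : (aeval B p).rank = (aeval A p).rank := by
  obtain ⟨P, rfl⟩ := h
  have hconj : aeval ((↑P : Matrix m m K) * A * (↑P⁻¹ : Matrix m m K)) p =
      (↑P : Matrix m m K) * aeval A p * (↑P⁻¹ : Matrix m m K) := by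
    induction p using Polynomial.induction_on' with
    | add p q hp hq => simp only [map_add, hp, hq, mul_add, add_mul]
    | monomial n a =>
      rw [aeval_monomial, aeval_monomial, ← Algebra.smul_def, ← Algebra.smul_def,
        mul_smul_comm, smul_mul_assoc, Units.conj_pow]
  rw [hconj, Matrix.rank_mul_eq_left_of_isUnit_det, Matrix.rank_mul_eq_right_of_isUnit_det]
  · exact (Matrix.isUnit_iff_isUnit_det _).1 P.isUnit
  · exact (Matrix.isUnit_iff_isUnit_det _).1 P⁻¹.isUnit

theorem Matrix.mul_natDegree_le_rank_aeval_pow {m : Type*} [Fintype m] [DecidableEq m]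
    {B : Matrix m m K} {f : K[X]} (hf : Irreducible f) {h : ℕ} (hB : minpoly K B = f ^ h) (k : ℕ) :
    f.natDegree * (h - k) ≤ (aeval B (f ^ k)).rank := by
  classical
  rcases le_or_gt h k with hk | hk
  · simp [Nat.sub_eq_zero_of_le hk]
  have hne : aeval B (f ^ (h - 1)) ≠ 0 := by
    intro h0
    have := minpoly.dvd K B h0
    rw [hB, pow_dvd_pow_iff hf.ne_zero hf.not_isUnit] at this
    omega
  obtain ⟨v, hv⟩ : ∃ v, aeval B (f ^ (h - 1)) *ᵥ v ≠ 0 := by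
    by_contra! hcon
    exact hne (Matrix.toLin'.injective (LinearMap.ext fun v => by
      rw [Matrix.toLin'_apply, hcon v, map_zero, LinearMap.zero_apply]))
  have inj (q : K[X]) (hq : aeval B q *ᵥ v = 0) : f ^ h ∣ q := by
    obtain ⟨j, hj, hassoc⟩ := (dvd_prime_pow hf.prime h).1 (EuclideanDomain.gcd_dvd_right q (f ^ h))
    have hgcd : aeval B (EuclideanDomain.gcd q (f ^ h)) *ᵥ v = 0 := by
      have h0 : aeval B (f ^ h) = 0 := hB ▸ minpoly.aeval K B
      rw [EuclideanDomain.gcd_eq_gcd_ab, map_add, mul_comm q, map_mul, map_mul, h0, zero_mul,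
        add_zero, ← Matrix.mulVec_mulVec, hq, Matrix.mulVec_zero]
    rcases hj.eq_or_lt with rfl | hlt
    · exact hassoc.symm.dvd.trans (EuclideanDomain.gcd_dvd_left q _)
    · obtain ⟨r, hr⟩ := hassoc.dvd.trans (pow_dvd_pow f (Nat.le_sub_one_of_lt hlt))
      refine absurd ?_ hv
      rw [hr, mul_comm, map_mul, ← Matrix.mulVec_mulVec, hgcd, Matrix.mulVec_zero]
  let T : degreeLT K (f.natDegree * (h - k)) →ₗ[K] LinearMap.range (aeval B (f ^ k)).mulVecLin :=
    { toFun := fun p => ⟨aeval B (f ^ k) *ᵥ (aeval B p.1 *ᵥ v), ⟨_, rfl⟩⟩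
      map_add' := fun p q => by
        ext1
        simp [Matrix.add_mulVec, Matrix.mulVec_add]
      map_smul' := fun c p => by
        ext1
        simp [Matrix.smul_mulVec, Matrix.mulVec_smul] }
  have hT : Function.Injective T := by
    rw [injective_iff_map_eq_zero]
    rintro ⟨p, hp⟩ h0
    have h1 : aeval B (f ^ k) *ᵥ (aeval B p *ᵥ v) = 0 := congrArg Subtype.val h0
    rw [Matrix.mulVec_mulVec, ← map_mul] at h1
    have h2 := inj _ h1
    rw [← Nat.add_sub_cancel' hk.le, pow_add] at h2
    have h3 := (mul_dvd_mul_iff_left (pow_ne_zero k hf.ne_zero)).1 h2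
    rw [mem_degreeLT] at hp
    have h4 : p = 0 := by
      refine eq_zero_of_dvd_of_degree_lt h3 (hp.trans_le ?_)
      rw [degree_pow, degree_eq_natDegree hf.ne_zero, mul_comm, nsmul_eq_mul, Nat.cast_mul]
    simp [h4]
  have := LinearMap.finrank_le_finrank_of_injective hT
  rwa [(degreeLTEquiv K _).finrank_eq, Module.finrank_fin_fun] at this

theorem Matrix.rank_aeval_pow_of_minpoly {m : Type*} [Fintype m] [DecidableEq m]
    {B : Matrix m m K} {f : K[X]} (hf : Irreducible f) {h : ℕ} (hB : minpoly K B = f ^ h)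
    (hcard : Fintype.card m = f.natDegree * h) (k : ℕ) :
    (aeval B (f ^ k)).rank = f.natDegree * (h - k) := by
  refine le_antisymm ?_ (Matrix.mul_natDegree_le_rank_aeval_pow hf hB k)
  rcases le_or_gt h k with hk | hk
  · have h0 : aeval B (f ^ k) = 0 := by
      rw [← Nat.add_sub_cancel' hk, pow_add, map_mul, ← hB, minpoly.aeval, zero_mul]
    simp [h0]
  · have hmul : aeval B (f ^ k) * aeval B (f ^ (h - k)) = 0 := by
      rw [← map_mul, ← pow_add, Nat.add_sub_cancel' hk.le, ← hB, minpoly.aeval]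
    have hle := Matrix.rank_add_rank_le_card_of_mul_eq_zero hmul
    have := Matrix.mul_natDegree_le_rank_aeval_pow hf hB (h - k)
    rw [Nat.sub_sub_self hk.le] at this
    rw [hcard] at hle
    rw [Nat.mul_sub]
    omega

theorem HasPrimaryCycleType.rank_aeval_pow {n m : ℕ} {M : Matrix (Fin n) (Fin n) K} {f : K[X]}
    (hf : Irreducible f) {lam : Nat.Partition m} (hM : HasPrimaryCycleType M f lam) (k : ℕ) :
    (aeval M (f ^ k)).rank = f.natDegree * (lam.parts.map (· - k)).sum := by
  obtain ⟨L, hL, B, hB, e, hsim⟩ := hM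
  have hreindex : aeval (Matrix.reindex e e (Matrix.blockDiagonal' B)) (f ^ k) =
      Matrix.reindex e e (aeval (Matrix.blockDiagonal' B) (f ^ k)) :=
    aeval_algHom_apply (Matrix.reindexAlgEquiv K K e).toAlgHom _ _
  rw [hsim.rank_aeval, hreindex, Matrix.rank_reindex, Polynomial.aeval_blockDiagonal',
    Matrix.rank_blockDiagonal', ← hL, Multiset.map_coe, Multiset.sum_coe,
    Finset.sum_congr rfl fun i _ =>
      Matrix.rank_aeval_pow_of_minpoly hf (hB i).2 (Fintype.card_fin _) k,
    ← Finset.mul_sum]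
  congr 1
  exact Fin.sum_univ_fun_getElem L (· - k)

end Rank

section Decomposition

variable {K : Type*} [Field K]

theorem exists_basis_toMatrix_root {g : K[X]} (hg : g.Monic) (h : ℕ) :
    ∃ b : Module.Basis (Fin (g.natDegree * h)) K (AdjoinRoot (g ^ h)),
      (Algebra.leftMulMatrix b (AdjoinRoot.root (g ^ h))).charpoly = g ^ h ∧
      minpoly K (Algebra.leftMulMatrix b (AdjoinRoot.root (g ^ h))) = g ^ h := by
  have hgh : (g ^ h).Monic := hg.pow h
  have hdim : (AdjoinRoot.powerBasis hgh.ne_zero).dim = g.natDegree * h := by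
    rw [AdjoinRoot.powerBasis_dim, natDegree_pow, mul_comm]
  have hmin := AdjoinRoot.minpoly_powerBasis_gen_of_monic hgh
  refine ⟨(AdjoinRoot.powerBasis hgh.ne_zero).basis.reindex (finCongr hdim), ?_, ?_⟩
  · have hmat : Algebra.leftMulMatrix
        ((AdjoinRoot.powerBasis hgh.ne_zero).basis.reindex (finCongr hdim))
        (AdjoinRoot.root (g ^ h)) = Matrix.reindex (finCongr hdim) (finCongr hdim)
        (Algebra.leftMulMatrix (AdjoinRoot.powerBasis hgh.ne_zero).basis
          (AdjoinRoot.powerBasis hgh.ne_zero).gen) := by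
      ext i j
      simp [Algebra.leftMulMatrix_apply, LinearMap.toMatrix_apply]
    rw [hmat, Matrix.charpoly_reindex, charpoly_leftMulMatrix, hmin]
  · rw [minpoly.algHom_eq _ (Algebra.leftMulMatrix_injective _)]
    exact hmin

theorem exists_pos_linearEquiv_pi_quotient_span {g : K[X]} {W : Type*} [AddCommGroup W]
    [Module K[X] W] {r : ℕ} {D : Fin r → ℕ} (e : W ≃ₗ[K[X]] ∀ i, K[X] ⧸ Ideal.span {g ^ D i}) :
    ∃ L : List ℕ, (∀ x ∈ L, 0 < x) ∧
      Nonempty (W ≃ₗ[K[X]] ∀ i : Fin L.length, K[X] ⧸ Ideal.span {g ^ L.get i}) := by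
  classical
  have of_tuple (c : ℕ) (D' : Fin c → ℕ) (hpos : ∀ j, 0 < D' j)
      (hW : Nonempty (W ≃ₗ[K[X]] ∀ j, K[X] ⧸ Ideal.span {g ^ D' j})) :
      ∃ L : List ℕ, (∀ x ∈ L, 0 < x) ∧
        Nonempty (W ≃ₗ[K[X]] ∀ i : Fin L.length, K[X] ⧸ Ideal.span {g ^ L.get i}) := by
    obtain ⟨L, hL⟩ := List.equivSigmaTuple.surjective ⟨c, D'⟩
    cases hL
    exact ⟨L, List.forall_mem_iff_get.2 hpos, hW⟩
  let ε := (Fintype.equivFin {i // 0 < D i}).symm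
  let T : (∀ i, K[X] ⧸ Ideal.span {g ^ D i}) →ₗ[K[X]]
      ∀ j, K[X] ⧸ Ideal.span {g ^ D (ε j).1} :=
    LinearMap.pi fun j => LinearMap.proj (ε j).1
  have hT : Function.Bijective T := by
    constructor
    · rw [injective_iff_map_eq_zero]
      intro y hy
      funext i
      rcases Nat.eq_zero_or_pos (D i) with hi | hi
      · have : Subsingleton (K[X] ⧸ Ideal.span {g ^ D i}) := by
          rw [Ideal.Quotient.subsingleton_iff, hi, pow_zero, Ideal.span_singleton_one]
        exact Subsingleton.elim _ _
      · obtain ⟨j, hj⟩ := ε.surjective ⟨i, hi⟩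
        have h1 : y (ε j).1 = 0 := congrFun hy j
        rw [hj] at h1
        exact h1
    · intro z
      refine ⟨∑ j, Pi.single (ε j).1 (z j), ?_⟩
      funext k
      change (∑ j, Pi.single (ε j).1 (z j) : ∀ i, K[X] ⧸ Ideal.span {g ^ D i}) (ε k).1 = z k
      rw [Finset.sum_apply, Finset.sum_eq_single k]
      · rw [Pi.single_eq_same]
      · intro j _ hj
        refine Pi.single_eq_of_ne (fun h => hj ?_) _
        exact (ε.injective (Subtype.ext h)).symm
      · simp
  exact of_tuple _ _ (fun j => (ε j).2) ⟨e.trans (LinearEquiv.ofBijective T hT)⟩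

theorem exists_hasPrimaryCycleType {n : ℕ} (Y : Matrix (Fin n) (Fin n) K) {g : K[X]}
    (hg : g.Monic) (hirr : Irreducible g) {N : ℕ} (hY : aeval Y (g ^ N) = 0) :
    ∃ (m : ℕ) (mu : Nat.Partition m), HasPrimaryCycleType Y g mu := by
  classical
  let φ : Module.End K (Fin n → K) := Matrix.toLin' Y
  have htors : Module.IsTorsion' (Module.AEval' φ) (Submonoid.powers g) := by
    rw [Submodule.isTorsion'_powers_iff]
    intro x
    refine ⟨N, (Module.AEval'.of φ).symm.injective ?_⟩
    have : aeval φ (g ^ N) = 0 := by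
      have := aeval_algHom_apply (Matrix.toLinAlgEquiv' (R := K) (n := Fin n)).toAlgHom Y (g ^ N)
      rw [hY, map_zero] at this
      exact this
    rw [map_zero]
    exact (Module.AEval.of_symm_smul _ _ _).trans (by rw [this, zero_smul])
  obtain ⟨r, D, ⟨e⟩⟩ := Module.torsion_by_prime_power_decomposition hirr htors
  obtain ⟨L, hL, ⟨e⟩⟩ := exists_pos_linearEquiv_pi_quotient_span (g := g)
    (e.trans (DirectSum.linearEquivFunOnFintype _ _ _))
  choose c hchar hmin using fun h => exists_basis_toMatrix_root hg h
  let B (i : Fin L.length) := Algebra.leftMulMatrix (c (L.get i)) (AdjoinRoot.root (g ^ L.get i))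
  let e' : Module.AEval' φ ≃ₗ[K] ∀ i : Fin L.length, AdjoinRoot (g ^ L.get i) :=
    { e with
      map_smul' := fun a w => by
        funext i
        change e (a • w) i = a • (show AdjoinRoot (g ^ L.get i) from e w i)
        rw [← Module.AEval.C_smul, map_smul, Pi.smul_apply]
        obtain ⟨p, hp⟩ := AdjoinRoot.mk_surjective (show AdjoinRoot (g ^ L.get i) from e w i)
        rw [← hp, AdjoinRoot.smul_mk, smul_eq_C_mul]
        rw [show e w i = _ from hp.symm]
        rfl }
  have he' (w : Module.AEval' φ) (i : Fin L.length) :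
      e' ((X : K[X]) • w) i = AdjoinRoot.root (g ^ L.get i) * e' w i := by
    obtain ⟨p, hp⟩ := AdjoinRoot.mk_surjective (e' w i)
    change e ((X : K[X]) • w) i = _
    rw [map_smul, Pi.smul_apply, show e w i = _ from hp.symm, ← hp, ← AdjoinRoot.mk_X, ← map_mul]
    rfl
  let b := ((Pi.basis fun i : Fin L.length => c (L.get i)).map
    e'.symm).map (Module.AEval'.of φ).symm
  let ι := b.indexEquiv (Pi.basisFun K (Fin n))
  refine ⟨L.sum, ⟨L, fun {i} hi => hL i hi, by simp⟩, L, rfl, B,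
    fun i => ⟨hchar _, hmin _⟩, ι, ?_⟩
  have hmat : LinearMap.toMatrix b b φ = Matrix.blockDiagonal' B := by
    ext ⟨i, s⟩ ⟨j, t⟩
    rw [LinearMap.toMatrix_apply]
    have h1 : b.repr (φ (b ⟨j, t⟩)) ⟨i, s⟩ =
        (c (L.get i)).repr (AdjoinRoot.root (g ^ L.get i) *
          (Pi.single j (c (L.get j) t) : ∀ i : Fin L.length, AdjoinRoot (g ^ L.get i)) i) s := by
      have h2 : e' (Module.AEval'.of φ (b ⟨j, t⟩)) = Pi.single j (c (L.get j) t) := by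
        simp only [b, Module.Basis.map_apply, LinearEquiv.apply_symm_apply, Pi.basis_apply]
      rw [← h2, ← he', Module.AEval'.X_smul_of]
      simp only [b, Module.Basis.map_repr, LinearEquiv.trans_apply, LinearEquiv.symm_symm,
        Pi.basis_repr]
    rw [h1]
    by_cases hij : i = j
    · subst hij
      rw [Matrix.blockDiagonal'_apply_eq, Pi.single_eq_same]
      exact (Algebra.leftMulMatrix_eq_repr_mul (c (L.get i)) _ s t).symm
    · rw [Matrix.blockDiagonal'_apply_ne _ _ _ hij, Pi.single_eq_of_ne hij, mul_zero, map_zero,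
        Finsupp.zero_apply]
  have hmat' : LinearMap.toMatrix (b.reindex ι) (b.reindex ι) φ =
      Matrix.reindex ι ι (Matrix.blockDiagonal' B) := by
    rw [← hmat]
    ext i j
    simp [LinearMap.toMatrix_apply]
  rw [← hmat']
  let std := Pi.basisFun K (Fin n)
  refine ⟨⟨std.toMatrix (b.reindex ι), (b.reindex ι).toMatrix std,
    Module.Basis.toMatrix_mul_toMatrix_flip _ _, Module.Basis.toMatrix_mul_toMatrix_flip _ _⟩, ?_⟩
  change Y = std.toMatrix (b.reindex ι) * LinearMap.toMatrix (b.reindex ι) (b.reindex ι) φ *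
    (b.reindex ι).toMatrix std
  rw [basis_toMatrix_mul_linearMap_toMatrix_mul_basis_toMatrix]
  exact (LinearMap.toMatrix'_toLin' Y).symm

end Decomposition

/-- Let `X` be a matrix over a field `K` with cycle type `f ^ λ` for a monic
irreducible polynomial `f` of degree `d`, and let `F ∈ K[x]` be any
polynomial.  Then `F(X)` has cycle type `g ^ μ` for a single monic
irreducible polynomial `g` whose degree `e` divides `d`, and the partition
`μ` satisfies `e * |μ| = d * |λ|` and `dλ` dominates `eμ`. -/
theorem stmt2 {K : Type*} [Field K] {n m : ℕ}
    (X : Matrix (Fin n) (Fin n) K) (f : Polynomial K)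
    (hmonic : f.Monic) (hirr : Irreducible f)
    (lam : Nat.Partition m) (hX : HasPrimaryCycleType X f lam)
    (F : Polynomial K) :
    ∃ (g : Polynomial K) (m' : ℕ) (mu : Nat.Partition m'),
      g.Monic ∧ Irreducible g ∧ g.natDegree ∣ f.natDegree ∧
      HasPrimaryCycleType (Polynomial.aeval X F) g mu ∧
      g.natDegree * m' = f.natDegree * m ∧
      MDominates (f.natDegree • lam.parts) (g.natDegree • mu.parts) := by
  have := Fact.mk hirr
  have : FiniteDimensional K (AdjoinRoot f) := (AdjoinRoot.powerBasis hirr.ne_zero).finite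
  have hint : IsIntegral K (aeval (AdjoinRoot.root f) F) := Algebra.IsIntegral.isIntegral _
  obtain ⟨g, hg⟩ : ∃ g, g = minpoly K (aeval (AdjoinRoot.root f) F) := ⟨_, rfl⟩
  have hgm : g.Monic := hg ▸ minpoly.monic hint
  have hgi : Irreducible g := hg ▸ minpoly.irreducible hint
  have hdeg : g.natDegree ∣ f.natDegree := by
    have := minpoly.degree_dvd hint
    rwa [(AdjoinRoot.powerBasis hirr.ne_zero).finrank, AdjoinRoot.powerBasis_dim, ← hg] at this
  obtain ⟨q, hq⟩ : f ∣ g.comp F := by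
    rw [← AdjoinRoot.mk_eq_zero, ← AdjoinRoot.aeval_eq, aeval_comp, hg, minpoly.aeval]
  have hrank := hX.rank_aeval_pow hirr
  have hpow (k : ℕ) : aeval (aeval X F) (g ^ k) = aeval X (f ^ k) * aeval X (q ^ k) := by
    rw [← map_mul, ← mul_pow, ← hq, ← aeval_comp, pow_comp]
  have hnil : aeval X (f ^ m) = 0 := by
    refine Matrix.eq_zero_of_rank_eq_zero ?_
    rw [hrank, mul_eq_zero]
    right
    rw [Multiset.sum_eq_zero_iff]
    intro x hx
    obtain ⟨p, hp, rfl⟩ := Multiset.mem_map.1 hx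
    exact Nat.sub_eq_zero_of_le (lam.le_of_mem_parts hp)
  obtain ⟨m', mu, hmu⟩ := exists_hasPrimaryCycleType (aeval X F) hgm hgi (N := m)
    (by rw [hpow, hnil, zero_mul])
  have hrank' := hmu.rank_aeval_pow hgi
  refine ⟨g, m', mu, hgm, hgi, hdeg, hmu, ?_, MDominates.of_sum_tsub_le fun k => ?_⟩
  · have h1 := hrank 0
    have h2 := hrank' 0
    simp only [pow_zero, map_one, Nat.sub_zero, Multiset.map_id', Nat.Partition.parts_sum] at h1 h2
    rw [← h1, ← h2]
  · rw [Multiset.map_nsmul, Multiset.map_nsmul, Multiset.sum_nsmul, Multiset.sum_nsmul,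
      smul_eq_mul, smul_eq_mul, ← hrank, ← hrank', hpow]
    exact Matrix.rank_mul_le_left _ _
end

section
/- Let C and D be similarity classes of n×n matrices over the finite field F_q. Then C and D have the same class type if and only if C and D are polynomial in one another, where D is said to be polynomial in C if there exists a polynomial F ∈ F_q[x] such that F(X) ∈ D for all X ∈ C. -/
open Polynomial Matrix

/-- `M` is similar to a direct sum of cyclic blocks, one for each pair `(f, h)`
in the list `c`, the block having characteristic polynomial and minimal
polynomial both equal to `f ^ h`. -/
def HasCycleTypeList {K : Type*} [Field K] {n : ℕ} (M : Matrix (Fin n) (Fin n) K)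
    (c : List (Polynomial K × ℕ)) : Prop :=
  ∃ B : (i : Fin c.length) →
      Matrix (Fin ((c.get i).1.natDegree * (c.get i).2))
             (Fin ((c.get i).1.natDegree * (c.get i).2)) K,
    (∀ i, (B i).charpoly = (c.get i).1 ^ (c.get i).2 ∧
          minpoly K (B i) = (c.get i).1 ^ (c.get i).2) ∧
    ∃ e : ((i : Fin c.length) × Fin ((c.get i).1.natDegree * (c.get i).2)) ≃ Fin n,
      SimilarMat (Matrix.reindex e e (Matrix.blockDiagonal' B)) M

/-- `M` has class type `T`, where a class type is recorded as the multiset of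
pairs `(d_i, λ_i)` consisting of the degree `d_i` of each of the distinct monic
irreducible polynomials `f_i` occurring in the cycle type
`f_1^{λ_1} ⋯ f_t^{λ_t}` of `M`, together with the associated partition `λ_i`
(a nonempty multiset of positive parts). -/
def HasClassType {K : Type*} [Field K] {n : ℕ} (M : Matrix (Fin n) (Fin n) K)
    (T : Multiset (ℕ × Multiset ℕ)) : Prop :=
  ∃ l : List (Polynomial K × Multiset ℕ),
    (l.map Prod.fst).Nodup ∧
    (∀ p ∈ l, p.1.Monic ∧ Irreducible p.1 ∧ p.2 ≠ 0 ∧ ∀ h ∈ p.2, 0 < h) ∧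
    T = ↑(l.map fun p => (p.1.natDegree, p.2)) ∧
    ∃ c : List (Polynomial K × ℕ),
      (↑c : Multiset (Polynomial K × ℕ)) = (l.map fun p => p.2.map fun h => (p.1, h)).sum ∧
      HasCycleTypeList M c

theorem similarMat_iff_exists_linearEquiv {m : Type*} [Fintype m] [DecidableEq m] {K : Type*}
    [Field K] (A B : Matrix m m K) :
    SimilarMat A B ↔ ∃ Ψ : (m → K) ≃ₗ[K] (m → K), ∀ v, Ψ (A *ᵥ v) = B *ᵥ Ψ v := by
  constructor
  · rintro ⟨P, rfl⟩
    refine ⟨Matrix.toLin'OfInv (M := (↑P⁻¹ : Matrix m m K)) (M' := ↑P) (by simp) (by simp),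
      fun v => ?_⟩
    change (P : Matrix m m K) *ᵥ (A *ᵥ v) = _ *ᵥ ((P : Matrix m m K) *ᵥ v)
    rw [Matrix.mulVec_mulVec, Matrix.mulVec_mulVec, mul_assoc, Units.inv_mul, mul_one]
  · rintro ⟨Ψ, hΨ⟩
    refine ⟨⟨LinearMap.toMatrix' (Ψ : (m → K) →ₗ[K] (m → K)),
      LinearMap.toMatrix' (Ψ.symm : (m → K) →ₗ[K] (m → K)), ?_, ?_⟩, ?_⟩
    · rw [← LinearMap.toMatrix'_comp]; simp
    · rw [← LinearMap.toMatrix'_comp]; simp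
    · simp only [Units.inv_mk]
      apply Matrix.toLin'.injective
      refine LinearMap.ext fun c => ?_
      simp [Matrix.toLin'_mul, hΨ]

namespace SimilarMat

variable {m : Type*} [Fintype m] [DecidableEq m] {K : Type*} [Field K] {A B C : Matrix m m K}

theorem refl (A : Matrix m m K) : SimilarMat A A := ⟨1, by simp⟩

theorem symm (h : SimilarMat A B) : SimilarMat B A := by
  obtain ⟨P, rfl⟩ := h
  exact ⟨P⁻¹, by simp [mul_assoc]⟩

theorem trans (h : SimilarMat A B) (h' : SimilarMat B C) : SimilarMat A C := by
  obtain ⟨P, rfl⟩ := h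
  obtain ⟨Q, rfl⟩ := h'
  exact ⟨Q * P, by simp [mul_assoc]⟩

theorem exists_algEquiv (h : SimilarMat A B) :
    ∃ φ : Matrix m m K ≃ₐ[K] Matrix m m K, φ A = B ∧ ∀ X, SimilarMat X (φ X) := by
  obtain ⟨P, rfl⟩ := h
  refine ⟨MulSemiringAction.toAlgEquiv K (Matrix m m K) (ConjAct.toConjAct P), ?_,
    fun X => ⟨P, ?_⟩⟩ <;>
  simp [ConjAct.units_smul_def]

theorem aeval (h : SimilarMat A B) (F : K[X]) :
    SimilarMat (Polynomial.aeval A F) (Polynomial.aeval B F) := by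
  obtain ⟨φ, rfl, hφ⟩ := h.exists_algEquiv
  rw [Polynomial.aeval_algHom_apply φ A F]
  exact hφ _

end SimilarMat

/-- If two families over finite types have the same multiset of values, they agree up to a
bijection of the index types. -/
theorem exists_equiv_comp_eq_of_map_univ_eq {ι κ α : Type*} [Fintype ι] [Fintype κ]
    {a : ι → α} {b : κ → α}
    (h : (Finset.univ : Finset ι).val.map a = (Finset.univ : Finset κ).val.map b) :
    ∃ σ : ι ≃ κ, ∀ i, b (σ i) = a i := by
  classical
  have hc (x : α) : Fintype.card {i // a i = x} = Fintype.card {j // b j = x} := by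
    have := congrArg (Multiset.count x) h
    rw [Multiset.count_map, Multiset.count_map] at this
    rw [Fintype.card_subtype, Fintype.card_subtype]
    simpa [Finset.card_def, Finset.filter_val, eq_comm] using this
  let τ (x : α) : {i // a i = x} ≃ {j // b j = x} := Fintype.equivOfCardEq (hc x)
  refine ⟨(Equiv.sigmaFiberEquiv a).symm.trans
    ((Equiv.sigmaCongrRight τ).trans (Equiv.sigmaFiberEquiv b)), fun i => ?_⟩
  exact (τ (a i) ⟨i, rfl⟩).2

theorem map_univ_get {α : Type*} (l : List α) :
    (Finset.univ : Finset (Fin l.length)).val.map l.get = (l : Multiset α) := by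
  rw [Fin.univ_val_map, List.ofFn_get]

section Cyclic

variable {K : Type*} [Field K] {n : ℕ}

/-- `M` acts on column vectors as multiplication by `x` does on `⨁ i, K[x]/(p i)`. -/
def IsDirectSumOfCyclic {ι : Type*} (M : Matrix (Fin n) (Fin n) K) (p : ι → K[X]) : Prop :=
  ∃ Φ : (Fin n → K) ≃ₗ[K] (∀ i, AdjoinRoot (p i)),
    ∀ v i, Φ (M *ᵥ v) i = AdjoinRoot.root (p i) * Φ v i

theorem Polynomial.exists_linearEquiv_adjoinRoot_comp {p q : K[X]} (i : K[X]) (hp : p ≠ 0)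
    (hq : minpoly K (AdjoinRoot.mk p i) = q) (hd : q.natDegree = p.natDegree) :
    ∃ θ : AdjoinRoot p ≃ₗ[K] AdjoinRoot q,
      ∀ a, θ (AdjoinRoot.mk p i * a) = AdjoinRoot.root q * θ a := by
  have : Module.Finite K (AdjoinRoot p) := (AdjoinRoot.powerBasis hp).finite
  have hint : IsIntegral K (AdjoinRoot.mk p i) := Algebra.IsIntegral.isIntegral _
  have hq0 : q ≠ 0 := hq ▸ minpoly.ne_zero hint
  have : Module.Finite K (AdjoinRoot q) := (AdjoinRoot.powerBasis hq0).finite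
  let L : AdjoinRoot q →ₐ[K] AdjoinRoot p :=
    AdjoinRoot.liftAlgHom q (Algebra.ofId K _) (AdjoinRoot.mk p i)
      (by rw [← hq]; exact minpoly.aeval K (AdjoinRoot.mk p i))
  have hroot : L (AdjoinRoot.root q) = AdjoinRoot.mk p i := by simp [L]
  have hinj : Function.Injective L := by
    rw [injective_iff_map_eq_zero]
    intro a ha
    obtain ⟨r, rfl⟩ := AdjoinRoot.mk_surjective a
    rw [← AdjoinRoot.aeval_eq, ← Polynomial.aeval_algHom_apply, hroot] at ha
    rw [AdjoinRoot.mk_eq_zero]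
    exact hq ▸ minpoly.dvd K _ ha
  let e := LinearEquiv.ofInjectiveOfFinrankEq L.toLinearMap hinj (by
    rw [(AdjoinRoot.powerBasis hp).finrank, (AdjoinRoot.powerBasis hq0).finrank]
    simpa using hd)
  refine ⟨e.symm, fun a => e.injective ?_⟩
  obtain ⟨b, rfl⟩ := e.surjective a
  have he : ∀ x, e x = L x := fun x => rfl
  rw [e.apply_symm_apply, e.symm_apply_apply, he, he, map_mul, hroot]

namespace IsDirectSumOfCyclic

variable {A B : Matrix (Fin n) (Fin n) K} {ι κ : Type*} {p q : ι → K[X]}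

theorem similarMat (hA : IsDirectSumOfCyclic A p) (hB : IsDirectSumOfCyclic B p) :
    SimilarMat A B := by
  obtain ⟨Φ, hΦ⟩ := hA
  obtain ⟨Θ, hΘ⟩ := hB
  rw [similarMat_iff_exists_linearEquiv]
  refine ⟨Φ.trans Θ.symm, fun v => Θ.injective (funext fun i => ?_)⟩
  simp [hΦ, hΘ]

theorem of_similarMat (hA : IsDirectSumOfCyclic A p) (h : SimilarMat B A) :
    IsDirectSumOfCyclic B p := by
  obtain ⟨Φ, hΦ⟩ := hA
  obtain ⟨Ψ, hΨ⟩ := (similarMat_iff_exists_linearEquiv _ _).1 h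
  exact ⟨Ψ.trans Φ, fun v i => by simp [hΨ, hΦ]⟩

theorem comp_equiv (hA : IsDirectSumOfCyclic A p) (σ : κ ≃ ι) :
    IsDirectSumOfCyclic A (fun k => p (σ k)) := by
  obtain ⟨Φ, hΦ⟩ := hA
  exact ⟨Φ.trans (LinearEquiv.piCongrLeft K (fun i => AdjoinRoot (p i)) σ).symm,
    fun v i => hΦ v (σ i)⟩

theorem apply_aeval (Φ : (Fin n → K) ≃ₗ[K] (∀ i, AdjoinRoot (p i)))
    (hΦ : ∀ v i, Φ (A *ᵥ v) i = AdjoinRoot.root (p i) * Φ v i) (F : K[X]) (v : Fin n → K)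
    (i : ι) : Φ (aeval A F *ᵥ v) i = AdjoinRoot.mk (p i) F * Φ v i := by
  induction F using Polynomial.induction_on' generalizing v with
  | add r s hr hs => simp [Matrix.add_mulVec, hr, hs, add_mul]
  | monomial k a =>
    induction k generalizing v with
    | zero =>
      rw [monomial_zero_left, aeval_C, Algebra.algebraMap_eq_smul_one, Matrix.smul_mulVec,
        Matrix.one_mulVec, map_smul, Pi.smul_apply, Algebra.smul_def]
      rfl
    | succ k ih =>
      rw [← monomial_mul_X, map_mul, aeval_X, ← Matrix.mulVec_mulVec, ih, hΦ, map_mul,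
        AdjoinRoot.mk_X, mul_assoc]

theorem aeval (hA : IsDirectSumOfCyclic A p) (F : K[X]) (hp : ∀ i, p i ≠ 0)
    (hq : ∀ i, minpoly K (AdjoinRoot.mk (p i) F) = q i)
    (hd : ∀ i, (q i).natDegree = (p i).natDegree) :
    IsDirectSumOfCyclic (Polynomial.aeval A F) q := by
  obtain ⟨Φ, hΦ⟩ := hA
  choose θ hθ using fun i =>
    Polynomial.exists_linearEquiv_adjoinRoot_comp F (hp i) (hq i) (hd i)
  refine ⟨Φ.trans (LinearEquiv.piCongrRight θ), fun v i => ?_⟩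
  simp [apply_aeval Φ hΦ, hθ]

end IsDirectSumOfCyclic

theorem IsDirectSumOfCyclic.restrict {A : Matrix (Fin n) (Fin n) K} {ι : Type*} {p : ι → K[X]}
    (hA : IsDirectSumOfCyclic A p) (s : ι → Prop) (hs : ∀ i, ¬ s i → p i = 1) :
    IsDirectSumOfCyclic A (fun i : {i // s i} => p i) := by
  classical
  obtain ⟨Φ, hΦ⟩ := hA
  have hsub (i : ι) (hi : ¬ s i) (a b : AdjoinRoot (p i)) : a = b := by
    obtain ⟨r, rfl⟩ := AdjoinRoot.mk_surjective a
    obtain ⟨t, rfl⟩ := AdjoinRoot.mk_surjective b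
    rw [AdjoinRoot.mk_eq_mk, hs i hi]
    exact one_dvd _
  let R : (∀ i, AdjoinRoot (p i)) →ₗ[K] (∀ i : {i // s i}, AdjoinRoot (p i)) :=
    LinearMap.pi fun i => LinearMap.proj (i : ι)
  have hR : Function.Bijective R := by
    refine ⟨fun a b hab => funext fun i => ?_, fun b =>
      ⟨fun i => if hi : s i then b ⟨i, hi⟩ else 0, funext fun i => ?_⟩⟩
    · by_cases hi : s i
      · exact congrFun hab ⟨i, hi⟩
      · exact hsub i hi _ _
    · simp [R, i.2]
  exact ⟨Φ.trans (LinearEquiv.ofBijective R hR), fun v i => hΦ v i⟩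

theorem exists_linearEquiv_adjoinRoot_of_associated {r p : K[X]} (h : Associated r p) :
    ∃ θ : (K[X] ⧸ (Submodule.span K[X] {r} : Ideal K[X])) ≃ₗ[K] AdjoinRoot p,
      ∀ a, θ ((X : K[X]) • a) = AdjoinRoot.root p * θ a := by
  refine ⟨(Ideal.quotientEquivAlgOfEq K
    (Ideal.span_singleton_eq_span_singleton.2 h)).toLinearEquiv, fun a => ?_⟩
  obtain ⟨a, rfl⟩ := Ideal.Quotient.mk_surjective a
  rfl

/-- Primary rational canonical form. -/
theorem exists_isDirectSumOfCyclic (A : Matrix (Fin n) (Fin n) K) :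
    ∃ (N : ℕ) (f : Fin N → K[X]) (h : Fin N → ℕ),
      (∀ i, (f i).Monic ∧ Irreducible (f i) ∧ 0 < h i) ∧
      IsDirectSumOfCyclic A (fun i => f i ^ h i) := by
  classical
  obtain ⟨ι, _, p, hp, e, ⟨E⟩⟩ := Module.equiv_directSum_of_isTorsion
    (Module.AEval.isTorsion_of_finiteDimensional K (Fin n → K) (Matrix.toLin' A))
  choose θ hθ using fun i =>
    exists_linearEquiv_adjoinRoot_of_associated ((associated_normalize (p i)).pow_pow (n := e i))
  let Θ := E.trans (DirectSum.linearEquivFunOnFintype K[X] ι _)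
  have hM : IsDirectSumOfCyclic A (fun i => normalize (p i) ^ e i) := by
    refine ⟨(Module.AEval'.of (Matrix.toLin' A)).trans
      ((Θ.restrictScalars K).trans (LinearEquiv.piCongrRight θ)), fun v i => ?_⟩
    have := Module.AEval'.X_smul_of (Matrix.toLin' A) v
    rw [Matrix.toLin'_apply] at this
    simp only [LinearEquiv.trans_apply, LinearEquiv.restrictScalars_apply,
      LinearEquiv.piCongrRight_apply]
    rw [← this, map_smul, Pi.smul_apply, hθ]
  have hM' := hM.restrict (fun i => 0 < e i) (fun i hi => by
    rw [Nat.eq_zero_of_not_pos hi, pow_zero])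
  let σ := (Fintype.equivFin {i // 0 < e i}).symm
  refine ⟨Fintype.card {i // 0 < e i}, fun k => normalize (p (σ k)), fun k => e (σ k),
    fun k => ⟨Polynomial.monic_normalize (hp _).ne_zero,
      (normalize_associated _).symm.irreducible (hp _), (σ k).2⟩, hM'.comp_equiv σ⟩

theorem AdjoinRoot.aeval_mk (p F r : K[X]) :
    aeval (AdjoinRoot.mk p F) r = AdjoinRoot.mk p (r.comp F) := by
  rw [comp_eq_aeval]
  exact Polynomial.aeval_algHom_apply (AdjoinRoot.mkₐ (R := K) p) F r

theorem AdjoinRoot.exists_minpoly_mk_eq_pow {f g F : K[X]} (hg : g.Monic) (hg' : Irreducible g)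
    (h : ℕ) (hf0 : f ≠ 0) (hdvd : f ∣ g.comp F) :
    ∃ k ≤ h, minpoly K (AdjoinRoot.mk (f ^ h) F) = g ^ k := by
  have : Module.Finite K (AdjoinRoot (f ^ h)) := (AdjoinRoot.powerBasis (pow_ne_zero h hf0)).finite
  have hd : minpoly K (AdjoinRoot.mk (f ^ h) F) ∣ g ^ h := by
    apply minpoly.dvd
    rw [AdjoinRoot.aeval_mk, AdjoinRoot.mk_eq_zero, pow_comp]
    exact pow_dvd_pow_of_dvd hdvd h
  obtain ⟨k, hk, hass⟩ := (dvd_prime_pow hg'.prime h).1 hd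
  exact ⟨k, hk, eq_of_monic_of_associated (minpoly.monic (Algebra.IsIntegral.isIntegral _))
    (hg.pow k) hass⟩

theorem AdjoinRoot.minpoly_mk_eq_pow_of_not_sq_dvd {f g F : K[X]} (hf : Irreducible f)
    (hg : g.Monic) (hg' : Irreducible g) (h : ℕ) (hdvd : f ∣ g.comp F)
    (hsq : ¬ f ^ 2 ∣ g.comp F) : minpoly K (AdjoinRoot.mk (f ^ h) F) = g ^ h := by
  obtain ⟨k, hk, hmin⟩ := AdjoinRoot.exists_minpoly_mk_eq_pow hg hg' h hf.ne_zero hdvd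
  obtain ⟨u, hu⟩ := hdvd
  have hfu : ¬ f ∣ u := fun hfu => hsq (by rw [hu, pow_two]; exact mul_dvd_mul_left f hfu)
  have h0 := minpoly.aeval K (AdjoinRoot.mk (f ^ h) F)
  rw [hmin, AdjoinRoot.aeval_mk, AdjoinRoot.mk_eq_zero, pow_comp, hu, mul_pow] at h0
  have hcop : IsCoprime (f ^ h) (u ^ k) := ((hf.coprime_iff_not_dvd).2 hfu).pow
  have hle : h ≤ k := (pow_dvd_pow_iff hf.ne_zero hf.not_isUnit).1 (hcop.dvd_of_dvd_mul_right h0)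
  rw [hmin, le_antisymm hk hle]

theorem AdjoinRoot.natDegree_le_natDegree_minpoly_mk {p F G : K[X]} (hp : p ≠ 0)
    (hG : AdjoinRoot.mk p (G.comp F) = AdjoinRoot.root p) :
    p.natDegree ≤ (minpoly K (AdjoinRoot.mk p F)).natDegree := by
  have : Module.Finite K (AdjoinRoot p) := (AdjoinRoot.powerBasis hp).finite
  have hq0 : minpoly K (AdjoinRoot.mk p F) ≠ 0 :=
    minpoly.ne_zero (Algebra.IsIntegral.isIntegral _)
  have : Module.Finite K (AdjoinRoot (minpoly K (AdjoinRoot.mk p F))) :=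
    (AdjoinRoot.powerBasis hq0).finite
  let L : AdjoinRoot (minpoly K (AdjoinRoot.mk p F)) →ₐ[K] AdjoinRoot p :=
    AdjoinRoot.liftAlgHom _ (Algebra.ofId K _) (AdjoinRoot.mk p F)
      (minpoly.aeval K (AdjoinRoot.mk p F))
  have hroot : L (AdjoinRoot.root _) = AdjoinRoot.mk p F := by
    convert! AdjoinRoot.liftAlgHom_root _ _ _ _
  have hsurj : Function.Surjective L := by
    intro a
    obtain ⟨r, rfl⟩ := AdjoinRoot.mk_surjective a
    refine ⟨Polynomial.aeval (Polynomial.aeval (AdjoinRoot.root _) G) r, ?_⟩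
    rw [← Polynomial.aeval_algHom_apply, ← Polynomial.aeval_algHom_apply, hroot,
      AdjoinRoot.aeval_mk, hG, AdjoinRoot.aeval_eq]
  have := LinearMap.finrank_le_finrank_of_surjective (f := L.toLinearMap) hsurj
  rwa [(AdjoinRoot.powerBasis hp).finrank, (AdjoinRoot.powerBasis hq0).finrank,
    AdjoinRoot.powerBasis_dim, AdjoinRoot.powerBasis_dim] at this

theorem AdjoinRoot.minpoly_mk_pow_of_comp_eq_root {f F G : K[X]} (hf : Irreducible f)
    {h : ℕ} (hh : 0 < h)
    (hG : AdjoinRoot.mk (f ^ h) (G.comp F) = AdjoinRoot.root (f ^ h)) :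
    minpoly K (AdjoinRoot.mk (f ^ h) F) = minpoly K (AdjoinRoot.mk f F) ^ h ∧
      (minpoly K (AdjoinRoot.mk f F)).natDegree = f.natDegree := by
  have : Fact (Irreducible f) := ⟨hf⟩
  have : Module.Finite K (AdjoinRoot f) := (AdjoinRoot.powerBasis hf.ne_zero).finite
  have hint : IsIntegral K (AdjoinRoot.mk f F) := Algebra.IsIntegral.isIntegral _
  have hdvd : f ∣ (minpoly K (AdjoinRoot.mk f F)).comp F := by
    rw [← AdjoinRoot.mk_eq_zero, ← AdjoinRoot.aeval_mk]
    exact minpoly.aeval K _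
  obtain ⟨k, hk, hmin⟩ := AdjoinRoot.exists_minpoly_mk_eq_pow (minpoly.monic hint)
    (minpoly.irreducible hint) h hf.ne_zero hdvd
  have hle := AdjoinRoot.natDegree_le_natDegree_minpoly_mk (pow_ne_zero h hf.ne_zero) hG
  have hle' : (minpoly K (AdjoinRoot.mk f F)).natDegree ≤ f.natDegree := by
    have := minpoly.natDegree_le (A := K) (AdjoinRoot.mk f F)
    rwa [(AdjoinRoot.powerBasis hf.ne_zero).finrank, AdjoinRoot.powerBasis_dim] at this
  rw [hmin, natDegree_pow, natDegree_pow] at hle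
  have hpos := minpoly.natDegree_pos hint
  have hd : (minpoly K (AdjoinRoot.mk f F)).natDegree = f.natDegree :=
    le_antisymm hle' (Nat.le_of_mul_le_mul_left (hle.trans (Nat.mul_le_mul_right _ hk)) hh)
  rw [hd] at hle hpos
  rw [hmin, le_antisymm hk (Nat.le_of_mul_le_mul_right hle hpos)]
  exact ⟨rfl, hd⟩

theorem Matrix.blockDiagonal'_mulVec_apply {ι R : Type*} [Fintype ι] [DecidableEq ι] [CommRing R]
    {N : ι → Type*} [∀ i, Fintype (N i)]
    (B : ∀ i, Matrix (N i) (N i) R) (v : (Σ i, N i) → R) (i : ι) (k : N i) :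
    (Matrix.blockDiagonal' B *ᵥ v) ⟨i, k⟩ = (B i *ᵥ fun j => v ⟨i, j⟩) k := by
  simp only [Matrix.mulVec, dotProduct, Fintype.sum_sigma]
  rw [Finset.sum_eq_single i]
  · simp
  · intro j _ hj
    exact Finset.sum_eq_zero fun x _ => by
      rw [Matrix.blockDiagonal'_apply_ne _ _ _ hj.symm, zero_mul]
  · simp

theorem isDirectSumOfCyclic_reindex_blockDiagonal' {ι : Type*} [Fintype ι] [DecidableEq ι]
    {N : ι → ℕ} {p : ι → K[X]} (B : ∀ i, Matrix (Fin (N i)) (Fin (N i)) K)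
    (e : (Σ i, Fin (N i)) ≃ Fin n)
    (hB : ∀ i, ∃ θ : (Fin (N i) → K) ≃ₗ[K] AdjoinRoot (p i),
      ∀ v, θ (B i *ᵥ v) = AdjoinRoot.root (p i) * θ v) :
    IsDirectSumOfCyclic (Matrix.reindex e e (Matrix.blockDiagonal' B)) p := by
  choose θ hθ using hB
  refine ⟨(LinearEquiv.funCongrLeft K K e).trans
    ((LinearEquiv.piCurry K (fun i (_ : Fin (N i)) => K)).trans (LinearEquiv.piCongrRight θ)),
    fun v i => ?_⟩
  simp only [LinearEquiv.trans_apply, LinearEquiv.piCongrRight_apply, ← hθ]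
  congr 1
  ext k
  have h1 : Matrix.reindex e e (Matrix.blockDiagonal' B) *ᵥ v =
      (Matrix.blockDiagonal' B *ᵥ (v ∘ e)) ∘ e.symm := by
    rw [Matrix.reindex_apply, Matrix.submatrix_mulVec_equiv, Equiv.symm_symm]
  rw [h1]
  have h2 := Matrix.blockDiagonal'_mulVec_apply B (v ∘ e) i k
  change (Matrix.blockDiagonal' B *ᵥ (v ∘ e)) (e.symm (e ⟨i, k⟩)) = _
  rw [Equiv.symm_apply_apply, h2]
  rfl

theorem exists_matrix_minpoly_eq {p : K[X]} (hp : p.Monic) {N : ℕ} (hN : p.natDegree = N) :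
    ∃ B : Matrix (Fin N) (Fin N) K, (B.charpoly = p ∧ minpoly K B = p) ∧
      ∃ θ : (Fin N → K) ≃ₗ[K] AdjoinRoot p, ∀ v, θ (B *ᵥ v) = AdjoinRoot.root p * θ v := by
  subst hN
  let b : Module.Basis (Fin p.natDegree) K (AdjoinRoot p) := (AdjoinRoot.powerBasis' hp).basis
  let B := Algebra.leftMulMatrix b (AdjoinRoot.root p)
  have hmin : minpoly K B = p := by
    rw [minpoly.algHom_eq (Algebra.leftMulMatrix b) (Algebra.leftMulMatrix_injective b),
      AdjoinRoot.minpoly_root hp.ne_zero, hp.leadingCoeff, inv_one, C_1, mul_one]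
  refine ⟨B, ⟨?_, hmin⟩, b.equivFun.symm, fun v => ?_⟩
  · refine eq_of_monic_of_dvd_of_natDegree_le hp B.charpoly_monic ?_ ?_
    · simpa only [hmin] using Matrix.minpoly_dvd_charpoly B
    · rw [Matrix.charpoly_natDegree_eq_dim, Fintype.card_fin]
  · apply b.equivFun.injective
    rw [LinearEquiv.apply_symm_apply]
    have := Algebra.leftMulMatrix_mulVec_repr b (AdjoinRoot.root p) (b.equivFun.symm v)
    have h2 : ⇑(b.repr (b.equivFun.symm v)) = v := b.equivFun.apply_symm_apply v
    rw [h2] at this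
    exact this

theorem exists_linearEquiv_adjoinRoot_of_minpoly_eq_pow {f : K[X]} {h N : ℕ} (hf : Irreducible f)
    (hN : N = f.natDegree * h) (hh : 0 < h) {B : Matrix (Fin N) (Fin N) K}
    (hB : minpoly K B = f ^ h) :
    ∃ θ : (Fin N → K) ≃ₗ[K] AdjoinRoot (f ^ h),
      ∀ v, θ (B *ᵥ v) = AdjoinRoot.root (f ^ h) * θ v := by
  classical
  have hp : f ^ h ≠ 0 := pow_ne_zero h hf.ne_zero
  have : Module.Finite K (AdjoinRoot (f ^ h)) := (AdjoinRoot.powerBasis hp).finite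
  obtain ⟨v, hv⟩ : ∃ v, aeval B (f ^ (h - 1)) *ᵥ v ≠ 0 := by
    by_contra! hcon
    have h0 : aeval B (f ^ (h - 1)) = 0 := by
      apply Matrix.toLin'.injective
      exact LinearMap.ext fun v => by
        rw [Matrix.toLin'_apply, hcon v, map_zero, LinearMap.zero_apply]
    have := minpoly.dvd K B h0
    rw [hB, pow_dvd_pow_iff hf.ne_zero hf.not_isUnit] at this
    omega
  let L : AdjoinRoot (f ^ h) →ₐ[K] Matrix (Fin N) (Fin N) K :=
    Ideal.Quotient.liftₐ (Ideal.span {f ^ h}) (aeval B) (fun a ha => by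
      obtain ⟨b, rfl⟩ := Ideal.mem_span_singleton.1 ha
      rw [← hB, map_mul, minpoly.aeval, zero_mul])
  have hL (r : K[X]) : L (AdjoinRoot.mk _ r) = aeval B r := rfl
  let ev : AdjoinRoot (f ^ h) →ₗ[K] (Fin N → K) :=
    { toFun := fun a => L a *ᵥ v
      map_add' := fun a b => by rw [map_add, Matrix.add_mulVec]
      map_smul' := fun a b => by rw [map_smul, Matrix.smul_mulVec, RingHom.id_apply] }
  have hinj : Function.Injective ev := by
    rw [injective_iff_map_eq_zero]
    intro a ha
    obtain ⟨r, rfl⟩ := AdjoinRoot.mk_surjective a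
    replace ha : aeval B r *ᵥ v = 0 := ha
    rw [AdjoinRoot.mk_eq_zero]
    by_contra hr
    obtain ⟨k, hk, hass⟩ := (dvd_prime_pow hf.prime h).1 (EuclideanDomain.gcd_dvd_right r (f ^ h))
    have hkh : k ≤ h - 1 := by
      by_contra hlt
      have : k = h := by omega
      subst this
      exact hr (hass.symm.dvd.trans (EuclideanDomain.gcd_dvd_left _ _))
    obtain ⟨s, t, hst⟩ : ∃ s t, f ^ (h - 1) = r * s + f ^ h * t := by
      obtain ⟨w, hw⟩ := hass.dvd.trans (pow_dvd_pow f hkh)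
      refine ⟨EuclideanDomain.gcdA r (f ^ h) * w, EuclideanDomain.gcdB r (f ^ h) * w, ?_⟩
      rw [hw, ← mul_assoc, ← mul_assoc, ← add_mul, ← EuclideanDomain.gcd_eq_gcd_ab]
    apply hv
    rw [hst, ← hB, map_add, map_mul (aeval B) (minpoly K B), minpoly.aeval, zero_mul, add_zero,
      mul_comm, map_mul, ← Matrix.mulVec_mulVec, ha, Matrix.mulVec_zero]
  let E := LinearEquiv.ofInjectiveOfFinrankEq ev hinj (by
    rw [(AdjoinRoot.powerBasis hp).finrank, AdjoinRoot.powerBasis_dim, Module.finrank_fin_fun,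
      natDegree_pow, hN, mul_comm])
  refine ⟨E.symm, fun w => E.injective ?_⟩
  obtain ⟨a, rfl⟩ := E.surjective w
  rw [E.apply_symm_apply, E.symm_apply_apply]
  change B *ᵥ (L a *ᵥ v) = L (AdjoinRoot.root _ * a) *ᵥ v
  rw [map_mul, ← Matrix.mulVec_mulVec, ← AdjoinRoot.mk_X, hL, aeval_X]

theorem hasCycleTypeList_iff {M : Matrix (Fin n) (Fin n) K} {c : List (K[X] × ℕ)}
    (hc : ∀ i, (c.get i).1.Monic ∧ Irreducible (c.get i).1 ∧ 0 < (c.get i).2) :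
    HasCycleTypeList M c ↔
      IsDirectSumOfCyclic M (fun i : Fin c.length => (c.get i).1 ^ (c.get i).2) := by
  constructor
  · rintro ⟨B, hB, e, hsim⟩
    refine (isDirectSumOfCyclic_reindex_blockDiagonal' B e fun i => ?_).of_similarMat hsim.symm
    exact exists_linearEquiv_adjoinRoot_of_minpoly_eq_pow (hc i).2.1 rfl (hc i).2.2 (hB i).2
  · intro hM
    have hdeg (i : Fin c.length) : ((c.get i).1 ^ (c.get i).2).natDegree =
        (c.get i).1.natDegree * (c.get i).2 := by rw [natDegree_pow, mul_comm]
    choose B hB hθ using fun i => exists_matrix_minpoly_eq ((hc i).1.pow (c.get i).2) (hdeg i)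
    have hcard : Fintype.card ((i : Fin c.length) ×
        Fin ((c.get i).1.natDegree * (c.get i).2)) = n := by
      obtain ⟨Φ, -⟩ := hM
      choose θ _ using hθ
      have := (Φ.trans ((LinearEquiv.piCongrRight θ).symm.trans
        (LinearEquiv.piCurry K (fun i (_ : Fin _) => K)).symm)).finrank_eq
      rw [Module.finrank_fin_fun, Module.finrank_fintype_fun_eq_card] at this
      exact this.symm
    let e := Fintype.equivFinOfCardEq hcard
    exact ⟨B, hB, e, (isDirectSumOfCyclic_reindex_blockDiagonal' B e hθ).similarMat hM⟩

theorem IsDirectSumOfCyclic.hasClassType {M : Matrix (Fin n) (Fin n) K} {N : ℕ}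
    {f : Fin N → K[X]} {h : Fin N → ℕ}
    (hf : ∀ i, (f i).Monic ∧ Irreducible (f i) ∧ 0 < h i)
    (hM : IsDirectSumOfCyclic M (fun i => f i ^ h i)) (ρ : Fin N → Fin N)
    (hρ : ∀ i, f (ρ i) = f i) (hρ' : ∀ i j, f i = f j → ρ i = ρ j) :
    HasClassType M ↑((Finset.univ.image ρ).toList.map fun r =>
      ((f r).natDegree, (Finset.univ.filter fun i => ρ i = r).val.map h)) := by
  refine ⟨(Finset.univ.image ρ).toList.map fun r =>
    (f r, (Finset.univ.filter fun i => ρ i = r).val.map h), ?_, ?_, ?_,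
    List.ofFn fun i => (f i, h i), ?_, ?_⟩
  · rw [List.map_map]
    refine List.Nodup.map_on ?_ (Finset.nodup_toList _)
    intro x hx y hy hxy
    simp only [Finset.mem_toList, Finset.mem_image, Finset.mem_univ, true_and] at hx hy
    obtain ⟨i, rfl⟩ := hx
    obtain ⟨j, rfl⟩ := hy
    simp only [Function.comp_apply, hρ] at hxy
    exact hρ' i j hxy
  · intro q hq
    simp only [List.mem_map, Finset.mem_toList, Finset.mem_image, Finset.mem_univ,
      true_and] at hq
    obtain ⟨-, ⟨i, rfl⟩, rfl⟩ := hq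
    refine ⟨(hf _).1, (hf _).2.1, ?_, ?_⟩
    · intro h0
      dsimp only at h0
      have hi : i ∈ Finset.univ.filter fun j => ρ j = ρ i := by simp
      exact Multiset.notMem_zero (h i) (h0 ▸ Multiset.mem_map_of_mem h hi)
    · intro k hk
      dsimp only at hk
      obtain ⟨j, -, rfl⟩ := Multiset.mem_map.1 hk
      exact (hf j).2.2
  · rw [List.map_map]
    rfl
  · rw [← Fin.univ_val_map, List.map_map]
    have h1 : (List.map ((fun p : K[X] × Multiset ℕ => p.2.map fun h => (p.1, h)) ∘ fun r =>
        (f r, (Finset.univ.filter fun i => ρ i = r).val.map h)) (Finset.univ.image ρ).toList).sum =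
        ∑ r ∈ Finset.univ.image ρ, ∑ i ∈ Finset.univ.filter (fun i => ρ i = r),
          ({(f i, h i)} : Multiset (K[X] × ℕ)) := by
      rw [Finset.sum_map_toList]
      refine Finset.sum_congr rfl fun r _ => ?_
      rw [Finset.sum_eq_multiset_sum, Function.comp_apply, Multiset.map_map,
        ← Multiset.sum_map_singleton (Multiset.map _ _), Multiset.map_map]
      refine congrArg Multiset.sum (Multiset.map_congr rfl fun i hi => ?_)
      have hi' : ρ i = r := by simpa using hi
      simp only [Function.comp_apply, ← hi', hρ]
    rw [h1, Finset.sum_fiberwise_of_maps_to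
        (fun i _ => Finset.mem_image_of_mem ρ (Finset.mem_univ i)),
      ← Multiset.sum_map_singleton (Multiset.map _ _), Multiset.map_map]
    rfl
  · have hget := exists_equiv_comp_eq_of_map_univ_eq (a := (List.ofFn fun i => (f i, h i)).get)
      (b := fun i => (f i, h i)) (by rw [map_univ_get, Fin.univ_val_map])
    obtain ⟨σ, hσ⟩ := hget
    rw [hasCycleTypeList_iff]
    · have := hM.comp_equiv σ
      convert this using 2 with i
      rw [← hσ i]
    · intro i
      rw [← hσ i]
      exact hf _

theorem HasClassType.of_similarMat {A B : Matrix (Fin n) (Fin n) K}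
    {T : Multiset (ℕ × Multiset ℕ)} (hA : HasClassType A T) (h : SimilarMat A B) :
    HasClassType B T := by
  obtain ⟨l, hl, hl', hT, c, hc, D, hD, e, he⟩ := hA
  exact ⟨l, hl, hl', hT, c, hc, D, hD, e, he.trans h⟩

theorem exists_hasClassType_aeval {A : Matrix (Fin n) (Fin n) K} {F G : K[X]}
    (hG : aeval (aeval A F) G = A) :
    ∃ T, HasClassType A T ∧ HasClassType (aeval A F) T := by
  obtain ⟨N, f, h, hf, hA⟩ := exists_isDirectSumOfCyclic A
  have hG' (i : Fin N) : AdjoinRoot.mk (f i ^ h i) (G.comp F) = AdjoinRoot.root (f i ^ h i) := by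
    classical
    obtain ⟨Φ, hΦ⟩ := hA
    have h1 := IsDirectSumOfCyclic.apply_aeval Φ hΦ (G.comp F) (Φ.symm 1) i
    rw [aeval_comp, hG, hΦ] at h1
    simpa using h1.symm
  have hf0 (i : Fin N) : f i ^ h i ≠ 0 := pow_ne_zero _ (hf i).2.1.ne_zero
  let g (i : Fin N) : K[X] := minpoly K (AdjoinRoot.mk (f i) F)
  have key (i : Fin N) := AdjoinRoot.minpoly_mk_pow_of_comp_eq_root (hf i).2.1 (hf i).2.2 (hG' i)
  have hB := hA.aeval F hf0 (q := fun i => g i ^ h i) (fun i => (key i).1) (fun i => by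
    rw [natDegree_pow, natDegree_pow, (key i).2])
  have hg (i : Fin N) : (g i).Monic ∧ Irreducible (g i) ∧ 0 < h i := by
    have : Fact (Irreducible (f i)) := ⟨(hf i).2.1⟩
    have : Module.Finite K (AdjoinRoot (f i)) :=
      (AdjoinRoot.powerBasis (hf i).2.1.ne_zero).finite
    have hint : IsIntegral K (AdjoinRoot.mk (f i) F) := Algebra.IsIntegral.isIntegral _
    exact ⟨minpoly.monic hint, minpoly.irreducible hint, (hf i).2.2⟩
  have hgf (i : Fin N) : g i ∣ (f i).comp G := by
    apply minpoly.dvd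
    have h1 : AdjoinRoot.mk (f i) (G.comp F) = AdjoinRoot.root (f i) := by
      have := hG' i
      rw [← AdjoinRoot.mk_X, AdjoinRoot.mk_eq_mk] at this ⊢
      exact (dvd_pow_self _ (hf i).2.2.ne').trans this
    rw [AdjoinRoot.aeval_mk, comp_assoc, ← AdjoinRoot.aeval_mk, h1, AdjoinRoot.aeval_eq,
      AdjoinRoot.mk_self]
  have hinj (i j : Fin N) (hij : g i = g j) : f i = f j := by
    by_contra hne
    have hcop : IsCoprime (f i) (f j) := by
      refine (hf i).2.1.coprime_iff_not_dvd.2 fun hd => hne ?_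
      exact eq_of_monic_of_associated (hf i).1 (hf j).1
        ((hf i).2.1.associated_of_dvd (hf j).2.1 hd)
    have hcop' : IsCoprime ((f i).comp G) ((f j).comp G) := hcop.map (compRingHom G)
    exact (hg i).2.1.not_isUnit (hcop'.isUnit_of_dvd' (hgf i) (hij ▸ hgf j))
  let ρ (i : Fin N) : Fin N := (Quotient.mk (Setoid.ker f) i).out
  have hρ (i : Fin N) : f (ρ i) = f i := Quotient.mk_out (s := Setoid.ker f) i
  have hρ' (i j : Fin N) (hij : f i = f j) : ρ i = ρ j :=
    congrArg Quotient.out (Quotient.sound (s := Setoid.ker f) hij)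
  refine ⟨_, hA.hasClassType hf ρ hρ hρ', ?_⟩
  have := hB.hasClassType hg ρ
    (fun i => by change minpoly K (AdjoinRoot.mk (f (ρ i)) F) = _; rw [hρ])
    (fun i j hij => hρ' i j (hinj i j hij))
  simpa only [g, (key _).2] using this

theorem exists_aeval_aeval_eq_of_similarMat {A : Matrix (Fin n) (Fin n) K} {F G : K[X]}
    (h : SimilarMat (aeval (aeval A F) G) A) : ∃ G' : K[X], aeval (aeval A F) G' = A := by
  have hle (X : Matrix (Fin n) (Fin n) K) (r : K[X]) :
      (Algebra.adjoin K {aeval X r}).toSubmodule ≤ (Algebra.adjoin K {X}).toSubmodule := by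
    exact Subalgebra.toSubmodule.monotone <| Algebra.adjoin_le
      (Set.singleton_subset_iff.2 (aeval_mem_adjoin_singleton K X))
  have hfin : Module.finrank K (Algebra.adjoin K {A}).toSubmodule =
      Module.finrank K (Algebra.adjoin K {aeval (aeval A F) G}).toSubmodule := by
    obtain ⟨φ, hφ, -⟩ := h.exists_algEquiv
    have h1 := AlgHom.map_adjoin_singleton φ.toAlgHom (aeval (aeval A F) G)
    have h2 := LinearEquiv.finrank_map_eq φ.toLinearEquiv
      (Algebra.adjoin K {aeval (aeval A F) G}).toSubmodule
    rw [← h2]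
    conv_lhs => rw [← hφ]
    exact congrArg (fun S : Subalgebra K (Matrix (Fin n) (Fin n) K) =>
      Module.finrank K S.toSubmodule) h1.symm
  have heq := Submodule.eq_of_le_of_finrank_le (hle A F)
    (hfin.le.trans (Submodule.finrank_mono (hle (aeval A F) G)))
  have hA : A ∈ Algebra.adjoin K {aeval A F} := by
    rw [← Subalgebra.mem_toSubmodule, heq]
    exact Algebra.self_mem_adjoin_singleton K A
  rw [Algebra.adjoin_singleton_eq_range_aeval] at hA
  exact hA

theorem Polynomial.exists_dvd_comp_not_sq_dvd_comp [Finite K] {f g : K[X]} (hf : Irreducible f)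
    (hg : Irreducible g) (hd : f.natDegree = g.natDegree) :
    ∃ r : K[X], f ∣ g.comp r ∧ ¬ f ^ 2 ∣ g.comp r := by
  have : Fact (Irreducible f) := ⟨hf⟩
  have : Fact (Irreducible g) := ⟨hg⟩
  have : Module.Finite K (AdjoinRoot f) := (AdjoinRoot.powerBasis hf.ne_zero).finite
  have : Finite (AdjoinRoot f) := Module.finite_of_finite K
  obtain ⟨φ⟩ := FiniteField.nonempty_algHom_of_finrank_dvd (F := K) (K := AdjoinRoot g)
    (L := AdjoinRoot f) (by
      rw [(AdjoinRoot.powerBasis hf.ne_zero).finrank, (AdjoinRoot.powerBasis hg.ne_zero).finrank,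
        AdjoinRoot.powerBasis_dim, AdjoinRoot.powerBasis_dim, hd])
  obtain ⟨r, hr⟩ := AdjoinRoot.mk_surjective (φ (AdjoinRoot.root g))
  have hfr : f ∣ g.comp r := by
    rw [← AdjoinRoot.mk_eq_zero, ← AdjoinRoot.aeval_mk, hr, Polynomial.aeval_algHom_apply,
      AdjoinRoot.aeval_eq, AdjoinRoot.mk_self, map_zero]
  by_cases h2 : f ^ 2 ∣ g.comp r
  swap
  · exact ⟨r, hfr, h2⟩
  have hder : ¬ f ∣ (derivative g).comp r := by
    intro hdvd
    have hcop : IsCoprime (g.comp r) ((derivative g).comp r) :=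
      IsCoprime.map (PerfectField.separable_of_irreducible hg) (compRingHom r)
    exact hf.not_isUnit (hcop.isUnit_of_dvd' hfr hdvd)
  have hexp : g.comp (r + f) ≡ g.comp r + (derivative g).comp r * f [SMOD Ideal.span {f ^ 2}] := by
    rw [SModEq.sub_mem, Ideal.mem_span_singleton]
    obtain ⟨k, hk⟩ := binomExpansion (g.map C) r f
    rw [derivative_map, eval_map, eval_map, eval_map] at hk
    refine ⟨k, ?_⟩
    simp only [comp, hk]
    ring
  rw [SModEq.sub_mem, Ideal.mem_span_singleton] at hexp
  refine ⟨r + f, ?_, fun hcon => hder ?_⟩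
  · have h3 := (dvd_pow_self f two_ne_zero).trans hexp
    exact (dvd_iff_dvd_of_dvd_sub h3).2 (dvd_add hfr (dvd_mul_left f _))
  · have h3 := (dvd_iff_dvd_of_dvd_sub hexp).1 hcon
    rw [dvd_add_right h2, pow_two] at h3
    exact (mul_dvd_mul_iff_right hf.ne_zero).1 h3

theorem Multiset.Rel.exists_map_fst_map_snd {α β : Type*} {r : α → β → Prop} {s : Multiset α}
    {t : Multiset β} (h : Multiset.Rel r s t) :
    ∃ m : Multiset (α × β), m.map Prod.fst = s ∧ m.map Prod.snd = t ∧ ∀ p ∈ m, r p.1 p.2 := by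
  induction h with
  | zero => exact ⟨0, by simp⟩
  | cons hab _ ih =>
    obtain ⟨m, rfl, rfl, hm⟩ := ih
    refine ⟨(_, _) ::ₘ m, by rw [Multiset.map_cons], by rw [Multiset.map_cons], fun p hp => ?_⟩
    rcases Multiset.mem_cons.1 hp with rfl | hp
    · exact hab
    · exact hm p hp

theorem exists_aeval_similarMat_of_hasClassType [Finite K] {A B : Matrix (Fin n) (Fin n) K}
    {T : Multiset (ℕ × Multiset ℕ)} (hA : HasClassType A T) (hB : HasClassType B T) :
    ∃ F : K[X], SimilarMat (aeval A F) B := by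
  obtain ⟨lA, hndA, hlA, hTA, cA, hcA, hA⟩ := hA
  obtain ⟨lB, -, hlB, hTB, cB, hcB, hB⟩ := hB
  obtain ⟨m, hmA, hmB, hm⟩ : ∃ m : Multiset ((K[X] × Multiset ℕ) × (K[X] × Multiset ℕ)),
      m.map Prod.fst = ↑lA ∧ m.map Prod.snd = ↑lB ∧
      ∀ p ∈ m, (p.1.1.natDegree, p.1.2) = (p.2.1.natDegree, p.2.2) := by
    have h1 := hTA.symm.trans hTB
    rw [← Multiset.map_coe, ← Multiset.map_coe, ← Multiset.rel_eq, Multiset.rel_map] at h1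
    exact h1.exists_map_fst_map_snd
  have hmemA (p) (hp : p ∈ m) : p.1 ∈ lA := by
    rw [← Multiset.mem_coe, ← hmA]; exact Multiset.mem_map_of_mem _ hp
  have hmemB (p) (hp : p ∈ m) : p.2 ∈ lB := by
    rw [← Multiset.mem_coe, ← hmB]; exact Multiset.mem_map_of_mem _ hp
  have hnd : (m.map fun p => p.1.1).Nodup := by
    have : (m.map fun p => p.1.1) = ↑(lA.map Prod.fst) := by
      rw [← Multiset.map_coe, ← hmA, Multiset.map_map]; rfl
    rw [this]
    exact hndA
  obtain ⟨F, hF⟩ : ∃ F : K[X], ∀ p ∈ m, p.1.1 ∣ p.2.1.comp F ∧ ¬ p.1.1 ^ 2 ∣ p.2.1.comp F := by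
    classical
    choose R hR using fun p : {p // p ∈ m.toFinset} =>
      Polynomial.exists_dvd_comp_not_sq_dvd_comp
        (hlA _ (hmemA p (Multiset.mem_toFinset.1 p.2))).2.1
        (hlB _ (hmemB p (Multiset.mem_toFinset.1 p.2))).2.1
        (Prod.ext_iff.1 (hm p (Multiset.mem_toFinset.1 p.2))).1
    have hpw : Pairwise (Function.onFun IsCoprime fun p : {p // p ∈ m.toFinset} =>
        Ideal.span {p.1.1.1 ^ 2}) := by
      intro p q hpq
      have hp := Multiset.mem_toFinset.1 p.2
      have hq := Multiset.mem_toFinset.1 q.2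
      rw [Function.onFun, Ideal.isCoprime_span_singleton_iff]
      refine IsCoprime.pow ((hlA _ (hmemA p hp)).2.1.coprime_iff_not_dvd.2 fun hd => hpq ?_)
      exact Subtype.ext (Multiset.inj_on_of_nodup_map hnd _ hp _ hq
        (eq_of_monic_of_associated (hlA _ (hmemA p hp)).1 (hlA _ (hmemA q hq)).1
          ((hlA _ (hmemA p hp)).2.1.associated_of_dvd (hlA _ (hmemA q hq)).2.1 hd)))
    obtain ⟨F, hF⟩ := Ideal.exists_forall_sub_mem_ideal hpw R
    refine ⟨F, fun p hp => ?_⟩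
    have hp' := Multiset.mem_toFinset.2 hp
    have hsq : p.1.1 ^ 2 ∣ p.2.1.comp F - p.2.1.comp (R ⟨p, hp'⟩) := by
      have h1 := Ideal.mem_span_singleton.1 (hF ⟨p, hp'⟩)
      rw [← AdjoinRoot.mk_eq_mk] at h1 ⊢
      rw [← AdjoinRoot.aeval_mk, h1, AdjoinRoot.aeval_mk]
    have hlin := (dvd_pow_self p.1.1 two_ne_zero).trans hsq
    rw [dvd_iff_dvd_of_dvd_sub hlin, dvd_iff_dvd_of_dvd_sub hsq]
    exact hR ⟨p, hp'⟩
  obtain ⟨w, hw⟩ : ∃ w : List (K[X] × K[X] × ℕ), (w : Multiset (K[X] × K[X] × ℕ)) =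
      m.bind fun p => p.1.2.map fun h => (p.1.1, p.2.1, h) := ⟨_, Multiset.coe_toList _⟩
  have hwm (t) (ht : t ∈ w) : ∃ p ∈ m, t.1 = p.1.1 ∧ t.2.1 = p.2.1 ∧ t.2.2 ∈ p.1.2 := by
    rw [← Multiset.mem_coe, hw, Multiset.mem_bind] at ht
    obtain ⟨p, hp, ht⟩ := ht
    obtain ⟨k, hk, rfl⟩ := Multiset.mem_map.1 ht
    exact ⟨p, hp, rfl, rfl, hk⟩
  have hwA : (cA : Multiset (K[X] × ℕ)) =
      (w : Multiset (K[X] × K[X] × ℕ)).map fun t => (t.1, t.2.2) := by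
    rw [hcA, hw, Multiset.map_bind, ← Multiset.sum_coe, ← Multiset.map_coe, ← hmA,
      Multiset.map_map, Multiset.bind, Multiset.join]
    simp [Multiset.map_map]
  have hwB : (cB : Multiset (K[X] × ℕ)) =
      (w : Multiset (K[X] × K[X] × ℕ)).map fun t => (t.2.1, t.2.2) := by
    rw [hcB, hw, Multiset.map_bind, ← Multiset.sum_coe, ← Multiset.map_coe, ← hmB,
      Multiset.map_map, Multiset.bind, Multiset.join]
    congr 1
    refine Multiset.map_congr rfl fun p hp => ?_
    have := (Prod.ext_iff.1 (hm p hp)).2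
    simp only at this
    simp [Multiset.map_map, this]
  have hreidx {c : List (K[X] × ℕ)} {φ : K[X] × K[X] × ℕ → K[X] × ℕ}
      {M : Matrix (Fin n) (Fin n) K} (hcM : HasCycleTypeList M c)
      (hc : (c : Multiset (K[X] × ℕ)) = (w : Multiset (K[X] × K[X] × ℕ)).map φ)
      (hφ : ∀ t ∈ w, (φ t).1.Monic ∧ Irreducible (φ t).1 ∧ 0 < (φ t).2) :
      IsDirectSumOfCyclic M (fun i : Fin w.length => (φ (w.get i)).1 ^ (φ (w.get i)).2) := by
    obtain ⟨σ, hσ⟩ := exists_equiv_comp_eq_of_map_univ_eq (a := φ ∘ w.get) (b := c.get)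
      (by rw [map_univ_get, hc, ← map_univ_get w, Multiset.map_map])
    rw [hasCycleTypeList_iff] at hcM
    · have := hcM.comp_equiv σ
      simp only [hσ] at this
      exact this
    · intro i
      obtain ⟨j, rfl⟩ := σ.surjective i
      rw [hσ]
      exact hφ _ (List.get_mem _ _)
  have hpropA (t) (ht : t ∈ w) : t.1.Monic ∧ Irreducible t.1 ∧ 0 < t.2.2 := by
    obtain ⟨p, hp, h1, -, h3⟩ := hwm t ht
    have := hlA _ (hmemA p hp)
    exact ⟨h1 ▸ this.1, h1 ▸ this.2.1, this.2.2.2 _ h3⟩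
  have hpropB (t) (ht : t ∈ w) : t.2.1.Monic ∧ Irreducible t.2.1 ∧ 0 < t.2.2 := by
    obtain ⟨p, hp, -, h2, h3⟩ := hwm t ht
    have := hlB _ (hmemB p hp)
    exact ⟨h2 ▸ this.1, h2 ▸ this.2.1, (hpropA t ht).2.2⟩
  have hA' := hreidx hA hwA hpropA
  have hB' := hreidx hB hwB hpropB
  refine ⟨F, (hA'.aeval F (fun i => ?_) (fun i => ?_) (fun i => ?_)).similarMat hB'⟩
  · exact pow_ne_zero _ (hpropA _ (List.get_mem _ _)).2.1.ne_zero
  · obtain ⟨p, hp, h1, h2, -⟩ := hwm _ (List.get_mem w i)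
    have := hF p hp
    rw [← h1, ← h2] at this
    exact AdjoinRoot.minpoly_mk_eq_pow_of_not_sq_dvd (hpropA _ (List.get_mem _ _)).2.1
      (hpropB _ (List.get_mem _ _)).1 (hpropB _ (List.get_mem _ _)).2.1 _ this.1 this.2
  · obtain ⟨p, hp, h1, h2, -⟩ := hwm _ (List.get_mem w i)
    have := (Prod.ext_iff.1 (hm p hp)).1
    simp only at this
    rw [natDegree_pow, natDegree_pow, h1, h2, this]

end Cyclic

/-- Let `C` and `D` be the similarity classes of the matrices `A` and `B` over
the finite field `F_q`.  Then `C` and `D` have the same class type if and only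
if `C` and `D` are polynomial in one another, where `D` is polynomial in `C`
if there is a polynomial `F ∈ F_q[x]` with `F(X) ∈ D` for all `X ∈ C`. -/
theorem stmt4 {K : Type*} [Field K] [Fintype K] {n : ℕ}
    (A B : Matrix (Fin n) (Fin n) K) :
    (∃ T : Multiset (ℕ × Multiset ℕ), HasClassType A T ∧ HasClassType B T) ↔
      ((∃ F : Polynomial K, ∀ X : Matrix (Fin n) (Fin n) K,
          SimilarMat X A → SimilarMat (Polynomial.aeval X F) B) ∧
       (∃ G : Polynomial K, ∀ Y : Matrix (Fin n) (Fin n) K,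
          SimilarMat Y B → SimilarMat (Polynomial.aeval Y G) A)) := by
  constructor
  · rintro ⟨T, hA, hB⟩
    obtain ⟨F, hF⟩ := exists_aeval_similarMat_of_hasClassType hA hB
    obtain ⟨G, hG⟩ := exists_aeval_similarMat_of_hasClassType hB hA
    exact ⟨⟨F, fun X hX => (hX.aeval F).trans hF⟩, ⟨G, fun Y hY => (hY.aeval G).trans hG⟩⟩
  · rintro ⟨⟨F, hF⟩, ⟨G, hG⟩⟩
    have hAB := hF A (SimilarMat.refl A)
    obtain ⟨G', hG'⟩ := exists_aeval_aeval_eq_of_similarMat (hG _ hAB)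
    obtain ⟨T, hT, hT'⟩ := exists_hasClassType_aeval hG'
    exact ⟨T, hT, hT'.of_similarMat hAB⟩
end

section
/- Let X and Y be n×n matrices over the finite field F_q having the same class type. Then the centralizer of X in Mat_n(F_q) and the centralizer of Y in Mat_n(F_q) are conjugate subalgebras: there exists g ∈ GL_n(F_q) such that g⁻¹·Cent(X)·g = Cent(Y). -/
open Polynomial Matrix

/-- The polynomial `f` divides `g ∘ p` exactly once. -/
def DvdCompOnce {K : Type*} [Field K] (p f g : K[X]) : Prop :=
  f ∣ g.comp p ∧ ¬ f ^ 2 ∣ g.comp p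

/-- Over a finite field, the roots of two irreducible polynomials of the same degree generate
the same extension, and the image of one root can be lifted to first order. -/
theorem exists_dvdCompOnce {K : Type*} [Field K] [Finite K] {f g : K[X]}
    (hf : Irreducible f) (hg : Irreducible g) (hd : f.natDegree = g.natDegree) :
    ∃ p, DvdCompOnce p f g := by
  have : Fact (Irreducible f) := ⟨hf⟩
  have : Fact (Irreducible g) := ⟨hg⟩
  have : Module.Finite K (AdjoinRoot f) := (AdjoinRoot.powerBasis hf.ne_zero).finite
  have : Finite (AdjoinRoot f) := Module.finite_of_finite K
  have hF : Module.finrank K (AdjoinRoot f) = f.natDegree := finrank_quotient_span_eq_natDegree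
  have hG : Module.finrank K (AdjoinRoot g) = g.natDegree := finrank_quotient_span_eq_natDegree
  obtain ⟨φ⟩ : Nonempty (AdjoinRoot g →ₐ[K] AdjoinRoot f) :=
    FiniteField.nonempty_algHom_of_finrank_dvd (by rw [hF, hG, hd])
  obtain ⟨q, hq⟩ := AdjoinRoot.mk_surjective (φ (AdjoinRoot.root g))
  have mk_comp (r s : K[X]) : AdjoinRoot.mk f (r.comp s) = aeval (AdjoinRoot.mk f s) r := by
    rw [← AdjoinRoot.aeval_eq, ← AdjoinRoot.aeval_eq, aeval_comp]
  have hroot : aeval (φ (AdjoinRoot.root g)) g = 0 := by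
    rw [aeval_algHom_apply, AdjoinRoot.aeval_eq, AdjoinRoot.mk_self, map_zero]
  have hq1 : f ∣ g.comp q := by rw [← AdjoinRoot.mk_eq_zero, mk_comp, hq, hroot]
  by_cases hq2 : f ^ 2 ∣ g.comp q
  · have hder : ¬ f ∣ (derivative g).comp q := by
      rw [← AdjoinRoot.mk_eq_zero, mk_comp, hq]
      exact (PerfectField.separable_of_irreducible hg).aeval_derivative_ne_zero hroot
    have taylor_eq : ∃ c, g.comp (q + f) =
        g.comp q + (derivative g).comp q * f + c * f ^ 2 := by
      obtain ⟨c, hc⟩ := exists_mul_sq_add_linear_part_eq_eval_add (g.map C) q f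
      refine ⟨c, ?_⟩
      simp only [derivative_map, eval_map] at hc
      rw [Polynomial.comp, Polynomial.comp, Polynomial.comp, ← hc]
      ring
    obtain ⟨c, hc⟩ := taylor_eq
    refine ⟨q + f, ?_, fun h => hder ?_⟩
    · rw [hc]
      exact dvd_add (dvd_add hq1 (dvd_mul_left _ _))
        (Dvd.intro_left (c * f) (by ring))
    · rw [hc, dvd_add_left (dvd_mul_left _ _), dvd_add_right hq2, sq] at h
      exact (mul_dvd_mul_iff_right hf.ne_zero).1 h
  · exact ⟨q, hq1, hq2⟩

theorem DvdCompOnce.congr {K : Type*} [Field K] {p q f g : K[X]} (h : DvdCompOnce p f g)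
    (hpq : f ^ 2 ∣ q - p) : DvdCompOnce q f g := by
  have key : f ^ 2 ∣ g.comp q - g.comp p := by
    have := sub_dvd_eval_sub q p (g.map C)
    simp only [eval_map] at this
    exact hpq.trans this
  have key1 : f ∣ g.comp q - g.comp p := (dvd_pow_self f two_ne_zero).trans key
  exact ⟨(dvd_iff_dvd_of_dvd_sub key1).2 h.1, fun h2 => h.2 ((dvd_iff_dvd_of_dvd_sub key).1 h2)⟩

/-- A single polynomial can be used for all pairs simultaneously, by the Chinese remainder
theorem. -/
theorem exists_forall_dvdCompOnce {K ι : Type*} [Field K] [Finite K] [Finite ι] (f g : ι → K[X])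
    (hf : ∀ i, Irreducible (f i)) (hmonic : ∀ i, (f i).Monic) (hinj : Function.Injective f)
    (hg : ∀ i, Irreducible (g i)) (hd : ∀ i, (f i).natDegree = (g i).natDegree) :
    ∃ p, ∀ i, DvdCompOnce p (f i) (g i) := by
  choose q hq using fun i => exists_dvdCompOnce (hf i) (hg i) (hd i)
  have hcop : Pairwise (Function.onFun IsCoprime fun i => Ideal.span {f i ^ 2}) := by
    intro i j hij
    rw [Function.onFun, Ideal.isCoprime_span_singleton_iff]
    refine IsCoprime.pow ((hf i).coprime_iff_not_dvd.2 fun hdvd => hij (hinj ?_))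
    exact eq_of_monic_of_associated (hmonic i) (hmonic j) ((hf i).associated_of_dvd (hf j) hdvd)
  obtain ⟨p, hp⟩ := Ideal.exists_forall_sub_mem_ideal hcop q
  exact ⟨p, fun i => (hq i).congr (Ideal.mem_span_singleton.1 (hp i))⟩

/-- An endomorphism annihilated by a prime power, but not by the preceding power, on a space of
the corresponding dimension, is multiplication by `X` on a quotient of `K[X]`. -/
theorem exists_surjective_of_primary_cyclic {K V : Type*} [Field K] [AddCommGroup V] [Module K V]
    [FiniteDimensional K V] {g : K[X]} (hg : Irreducible g) (k : ℕ) (b : Module.End K V)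
    (h0 : aeval b (g ^ (k + 1)) = 0) (h1 : aeval b (g ^ k) ≠ 0)
    (hdim : Module.finrank K V = (g ^ (k + 1)).natDegree) :
    ∃ φ : K[X] →ₗ[K] V, Function.Surjective φ ∧
      LinearMap.ker φ = (Ideal.span {g ^ (k + 1)}).restrictScalars K ∧
      ∀ r, φ (X * r) = b (φ r) := by
  obtain ⟨v, hv⟩ : ∃ v, aeval b (g ^ k) v ≠ 0 := by
    by_contra! h
    exact h1 (LinearMap.ext h)
  let φ : K[X] →ₗ[K] V := LinearMap.applyₗ v ∘ₗ (aeval b).toLinearMap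
  have hφ (r : K[X]) : φ r = aeval b r v := rfl
  have hmul (r s : K[X]) : φ (r * s) = aeval b r (φ s) := by simp [hφ]
  have hker : LinearMap.ker φ = (Ideal.span {g ^ (k + 1)}).restrictScalars K := by
    ext r
    rw [LinearMap.mem_ker, Submodule.restrictScalars_mem, Ideal.mem_span_singleton]
    constructor
    · intro hr
      classical
      obtain ⟨j, hj, hassoc⟩ :=
        (dvd_prime_pow hg.prime _).1 (EuclideanDomain.gcd_dvd_right r (g ^ (k + 1)))
      have hgcd : φ (EuclideanDomain.gcd r (g ^ (k + 1))) = 0 := by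
        rw [EuclideanDomain.gcd_eq_gcd_ab, map_add, mul_comm, hmul, hr, mul_comm (g ^ (k + 1)),
          hmul, hφ (g ^ (k + 1)), h0]
        simp
      rcases hj.lt_or_eq with hlt | rfl
      · obtain ⟨s, hs⟩ := hassoc.dvd.trans (pow_dvd_pow g (Nat.lt_succ_iff.1 hlt))
        refine absurd ?_ hv
        rw [← hφ, hs, mul_comm, hmul, hgcd, map_zero]
      · exact hassoc.symm.dvd.trans (EuclideanDomain.gcd_dvd_left _ _)
    · rintro ⟨s, rfl⟩
      rw [mul_comm, hmul, hφ (g ^ (k + 1)), h0]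
      simp
  refine ⟨φ, ?_, hker, fun r => by rw [hmul, aeval_X]⟩
  rw [← LinearMap.range_eq_top]
  apply Submodule.eq_top_of_finrank_eq
  rw [← φ.quotKerEquivRange.finrank_eq, hdim, hker]
  exact finrank_quotient_span_eq_natDegree

/-- Two endomorphisms as in `exists_surjective_of_primary_cyclic` are similar. -/
theorem exists_equiv_of_primary_cyclic {K V W : Type*} [Field K] [AddCommGroup V] [Module K V]
    [FiniteDimensional K V] [AddCommGroup W] [Module K W] [FiniteDimensional K W]
    {g : K[X]} (hg : Irreducible g) (k : ℕ) (b : Module.End K V) (c : Module.End K W)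
    (hb0 : aeval b (g ^ (k + 1)) = 0) (hb1 : aeval b (g ^ k) ≠ 0)
    (hb : Module.finrank K V = (g ^ (k + 1)).natDegree)
    (hc0 : aeval c (g ^ (k + 1)) = 0) (hc1 : aeval c (g ^ k) ≠ 0)
    (hc : Module.finrank K W = (g ^ (k + 1)).natDegree) :
    ∃ e : V ≃ₗ[K] W, ∀ v, e (b v) = c (e v) := by
  obtain ⟨φ, hφ, hφk, hφX⟩ := exists_surjective_of_primary_cyclic hg k b hb0 hb1 hb
  obtain ⟨ψ, hψ, hψk, hψX⟩ := exists_surjective_of_primary_cyclic hg k c hc0 hc1 hc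
  let e : V ≃ₗ[K] W := (φ.quotKerEquivOfSurjective hφ).symm ≪≫ₗ
    Submodule.quotEquivOfEq _ _ (hφk.trans hψk.symm) ≪≫ₗ ψ.quotKerEquivOfSurjective hψ
  have he (r : K[X]) : e (φ r) = ψ r := by
    have : (φ.quotKerEquivOfSurjective hφ).symm (φ r) = Submodule.Quotient.mk r := by
      rw [LinearEquiv.symm_apply_eq]
      rfl
    simp only [e, LinearEquiv.trans_apply, this]
    rfl
  refine ⟨e, fun v => ?_⟩
  obtain ⟨r, rfl⟩ := hφ v
  rw [← hφX, he, he, hψX]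

/-- Evaluating `p` turns a cyclic block with minimal polynomial `f ^ h` into a cyclic block with
minimal polynomial `g ^ h`. -/
theorem DvdCompOnce.exists_equiv {K V W : Type*} [Field K] [AddCommGroup V] [Module K V]
    [FiniteDimensional K V] [AddCommGroup W] [Module K W] [FiniteDimensional K W]
    {p f g : K[X]} (hp : DvdCompOnce p f g) (hf : Irreducible f) (hg : Irreducible g)
    (hd : f.natDegree = g.natDegree) {h : ℕ} (hh : 0 < h) (b : Module.End K V)
    (c : Module.End K W) (hbm : minpoly K b = f ^ h) (hcm : minpoly K c = g ^ h)
    (hb : Module.finrank K V = f.natDegree * h) (hc : Module.finrank K W = g.natDegree * h) :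
    ∃ e : V ≃ₗ[K] W, ∀ v, e (aeval b p v) = c (e v) := by
  obtain ⟨k, rfl⟩ := Nat.exists_eq_add_one.2 hh
  have not_pow_dvd {q : K[X]} (hq : Irreducible q) : ¬ q ^ (k + 1) ∣ q ^ k := fun hdvd => by
    have := (pow_dvd_pow_iff hq.ne_zero hq.not_isUnit).1 hdvd
    omega
  have hcomp (j : ℕ) : aeval (aeval b p) (g ^ j) = aeval b (g.comp p ^ j) := by
    rw [map_pow, map_pow, aeval_comp]
  refine exists_equiv_of_primary_cyclic hg k _ c ?_ ?_ ?_ ?_ ?_ ?_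
  · rw [hcomp, ← minpoly.dvd_iff, hbm]
    exact pow_dvd_pow_of_dvd hp.1 _
  · rw [hcomp, Ne, ← minpoly.dvd_iff, hbm]
    obtain ⟨u, hu⟩ := hp.1
    rw [hu, mul_pow, pow_succ, mul_dvd_mul_iff_left (pow_ne_zero k hf.ne_zero)]
    intro hdvd
    apply hp.2
    rw [hu, sq]
    exact mul_dvd_mul_left _ (hf.prime.dvd_of_dvd_pow hdvd)
  · rw [hb, natDegree_pow, hd, mul_comm]
  · rw [← minpoly.dvd_iff, hcm]
  · rw [Ne, ← minpoly.dvd_iff, hcm]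
    exact not_pow_dvd hg
  · rw [hc, natDegree_pow, mul_comm]

theorem List.Forall₂.multisetRel {α β : Type*} {r : α → β → Prop} {l : List α} {l' : List β}
    (h : List.Forall₂ r l l') : Multiset.Rel r l l' := by
  induction h with
  | nil => exact .zero
  | cons h _ ih => exact .cons h ih

theorem Multiset.Rel.exists_perm_forall₂ {α β : Type*} {r : α → β → Prop} {l : List α}
    {l' : List β} (h : Multiset.Rel r l l') : ∃ l'', l''.Perm l' ∧ List.Forall₂ r l l'' := by
  induction l generalizing l' with
  | nil =>
    rw [Multiset.coe_nil, Multiset.rel_zero_left, Multiset.coe_eq_zero] at h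
    exact ⟨[], by simp [h], .nil⟩
  | cons a l ih =>
    rw [← Multiset.cons_coe, Multiset.rel_cons_left] at h
    obtain ⟨b, bs, hab, hrel, hl'⟩ := h
    induction bs using Quotient.inductionOn with | _ bs
    obtain ⟨m, hm, hlm⟩ := ih hrel
    exact ⟨b :: m, (hm.cons b).trans (Multiset.coe_eq_coe.1 hl').symm, .cons hab hlm⟩

theorem Multiset.Rel.exists_equiv {α β : Type*} {r : α → β → Prop} {l : List α} {l' : List β}
    (h : Multiset.Rel r l l') :
    ∃ e : Fin l.length ≃ Fin l'.length, ∀ i, r (l.get i) (l'.get (e i)) := by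
  classical
  obtain ⟨m, hm, hlm⟩ := h.exists_perm_forall₂
  obtain ⟨hlen, hget⟩ := List.forall₂_iff_get.1 hlm
  refine ⟨(finCongr hlen).trans ⟨hm.idxBij, hm.symm.idxBij, fun _ => hm.idxBij_symm_idxBij,
    fun _ => hm.idxBij_idxBij_symm⟩, fun i => ?_⟩
  have := hm.getElem_idxBij_eq_getElem (finCongr hlen i)
  have h2 := hget i i.2 (hlen ▸ i.2)
  simp only [List.get_eq_getElem, Equiv.trans_apply, Equiv.coe_fn_mk] at h2 ⊢
  rw [this]
  exact h2

/-- A similarity of matrices as a linear equivalence intertwining them. -/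
theorem SimilarMat.exists_equiv {m K : Type*} [Fintype m] [DecidableEq m] [Field K]
    {A B : Matrix m m K} (h : SimilarMat A B) :
    ∃ e : (m → K) ≃ₗ[K] (m → K), ∀ v, e (B *ᵥ v) = A *ᵥ e v := by
  obtain ⟨P, rfl⟩ := h
  refine ⟨.ofLinearMap (Matrix.mulVecLin (↑P⁻¹ : Matrix m m K)) (Matrix.mulVecLin (P : Matrix m m K))
    ?_ ?_, fun v => ?_⟩
  · rw [← Matrix.mulVecLin_mul, Units.inv_mul, Matrix.mulVecLin_one]
  · rw [← Matrix.mulVecLin_mul, Units.mul_inv, Matrix.mulVecLin_one]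
  · simp [Matrix.mulVec_mulVec, ← mul_assoc]

theorem blockDiagonal'_mulVec {ι K : Type*} [Fintype ι] [DecidableEq ι] [Field K] {m : ι → Type*}
    [∀ i, Fintype (m i)] (B : ∀ i, Matrix (m i) (m i) K) (v : (Σ i, m i) → K) (i : ι) (x : m i) :
    (Matrix.blockDiagonal' B *ᵥ v) ⟨i, x⟩ = (B i *ᵥ fun y => v ⟨i, y⟩) x := by
  simp only [Matrix.mulVec, dotProduct, Fintype.sum_sigma]
  rw [Finset.sum_eq_single i]
  · simp [Matrix.blockDiagonal'_apply_eq]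
  · intro j _ hj
    simp [Matrix.blockDiagonal'_apply_ne B _ _ hj.symm]
  · simp

/-- A cycle type gives a decomposition of the space into cyclic subspaces. -/
theorem HasCycleTypeList.exists_equiv {K : Type*} [Field K] {n : ℕ}
    {M : Matrix (Fin n) (Fin n) K} {c : List (K[X] × ℕ)} (h : HasCycleTypeList M c) :
    ∃ (b : ∀ i, Module.End K (Fin ((c.get i).1.natDegree * (c.get i).2) → K))
      (e : (Fin n → K) ≃ₗ[K] ∀ i, Fin ((c.get i).1.natDegree * (c.get i).2) → K),
      (∀ i, minpoly K (b i) = (c.get i).1 ^ (c.get i).2) ∧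
      ∀ v i, e (Matrix.toLin' M v) i = b i (e v i) := by
  obtain ⟨B, hB, ε, hsim⟩ := h
  obtain ⟨e, he⟩ := hsim.exists_equiv
  refine ⟨fun i => Matrix.toLin' (B i), e ≪≫ₗ LinearEquiv.funCongrLeft K K ε ≪≫ₗ
    LinearEquiv.piCurry K fun i (_ : Fin ((c.get i).1.natDegree * (c.get i).2)) => K, fun i => ?_, fun v i => ?_⟩
  · rw [Matrix.minpoly_toLin', (hB i).2]
  · ext x
    have : (Matrix.reindex ε ε (Matrix.blockDiagonal' B) *ᵥ e v) (ε ⟨i, x⟩) =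
        (Matrix.blockDiagonal' B *ᵥ (e v ∘ ε)) ⟨i, x⟩ := by
      rw [Matrix.reindex_apply, Matrix.submatrix_mulVec_equiv]
      simp
    change e (M *ᵥ v) (ε ⟨i, x⟩) = (B i *ᵥ fun y => e v (ε ⟨i, y⟩)) x
    rw [he, this, blockDiagonal'_mulVec]
    rfl

theorem aeval_apply_pi {K V ι : Type*} [Field K] [AddCommGroup V] [Module K V] {W : ι → Type*}
    [∀ i, AddCommGroup (W i)] [∀ i, Module K (W i)] (M : Module.End K V)
    (b : ∀ i, Module.End K (W i)) (e : V →ₗ[K] ∀ i, W i)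
    (h : ∀ v i, e (M v) i = b i (e v i)) (p : K[X]) (v : V) (i : ι) :
    e (aeval M p v) i = aeval (b i) p (e v i) := by
  induction p using Polynomial.induction_on' generalizing v with
  | add p q hp hq => simp [hp, hq]
  | monomial k a =>
    simp only [aeval_monomial, Module.algebraMap_end_eq_smul_id, Module.End.mul_apply,
      LinearMap.smul_apply, LinearMap.id_apply, map_smul, Pi.smul_apply]
    congr 1
    induction k generalizing v with
    | zero => simp
    | succ k ih => rw [pow_succ, pow_succ, Module.End.mul_apply, Module.End.mul_apply, ih, h]

/-- If the blocks of `X` and `Y` correspond via `p`, then `p(X)` is similar to `Y`. -/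
theorem exists_equiv_aeval {K : Type*} [Field K] {n : ℕ} {X Y : Matrix (Fin n) (Fin n) K}
    {c d : List (K[X] × ℕ)} (hX : HasCycleTypeList X c) (hY : HasCycleTypeList Y d) (p : K[X])
    (hcd : Multiset.Rel (fun a b : K[X] × ℕ => a.2 = b.2 ∧ 0 < a.2 ∧ Irreducible a.1 ∧ Irreducible b.1 ∧
      a.1.natDegree = b.1.natDegree ∧ DvdCompOnce p a.1 b.1) c d) :
    ∃ e : (Fin n → K) ≃ₗ[K] (Fin n → K),
      ∀ v, e (aeval (Matrix.toLin' X) p v) = Matrix.toLin' Y (e v) := by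
  obtain ⟨σ, hσ⟩ := hcd.exists_equiv
  obtain ⟨b, eX, hb, heX⟩ := hX.exists_equiv
  obtain ⟨b', eY, hb', heY⟩ := hY.exists_equiv
  have blocks (i) : ∃ e : (Fin ((c.get i).1.natDegree * (c.get i).2) → K) ≃ₗ[K]
      (Fin ((d.get (σ i)).1.natDegree * (d.get (σ i)).2) → K),
      ∀ v, e (aeval (b i) p v) = b' (σ i) (e v) := by
    obtain ⟨hh, hpos, hf, hg, hdeg, hp⟩ := hσ i
    exact hp.exists_equiv hf hg hdeg hpos (b i) (b' (σ i)) (hb i) (by rw [hb', hh])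
      (by rw [Module.finrank_fin_fun]) (by rw [Module.finrank_fin_fun, hh])
  choose ε hε using blocks
  let s := LinearEquiv.piCongrRight ε ≪≫ₗ LinearEquiv.piCongrLeft K
    (fun j => Fin ((d.get j).1.natDegree * (d.get j).2) → K) σ
  have hs (w) (i) : s w (σ i) = ε i (w i) :=
    Equiv.piCongrLeft_apply_apply (fun j => Fin ((d.get j).1.natDegree * (d.get j).2) → K) σ
      (fun i => ε i (w i)) i
  refine ⟨eX ≪≫ₗ s ≪≫ₗ eY.symm, fun v => ?_⟩
  apply eY.injective
  funext j
  obtain ⟨i, rfl⟩ := σ.surjective j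
  rw [heY]
  simp only [LinearEquiv.trans_apply, LinearEquiv.apply_symm_apply, hs]
  rw [← hε]
  congr 1
  exact aeval_apply_pi _ b eX.toLinearMap heX p v i

theorem exists_units_mul_aeval_eq {K : Type*} [Field K] [Finite K] {n : ℕ}
    {X Y : Matrix (Fin n) (Fin n) K} {T : Multiset (ℕ × Multiset ℕ)}
    (hX : HasClassType X T) (hY : HasClassType Y T) :
    ∃ (p : K[X]) (P : (Matrix (Fin n) (Fin n) K)ˣ),
      (P : Matrix (Fin n) (Fin n) K) * aeval X p = Y * P := by
  obtain ⟨l, hnodup, hl, hTl, c, hc, hXc⟩ := hX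
  obtain ⟨m, -, hm, hTm, d, hd, hYd⟩ := hY
  have hrel : Multiset.Rel (fun a b : K[X] × Multiset ℕ =>
      (a.1.natDegree, a.2) = (b.1.natDegree, b.2)) l m := by
    rw [← Multiset.rel_map (p := Eq), Multiset.rel_eq, Multiset.map_coe, Multiset.map_coe,
      ← hTl, hTm]
  replace hrel := hrel.mono (p := fun a b => (a.1.natDegree = b.1.natDegree ∧ a.2 = b.2) ∧
      (Irreducible b.1)) fun a _ b hb hab => ⟨Prod.mk.inj hab, (hm b hb).2.1⟩
  obtain ⟨m', hm', hlm⟩ := hrel.exists_perm_forall₂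
  obtain ⟨hlen, hget⟩ := List.forall₂_iff_get.1 hlm
  obtain ⟨p, hp⟩ := exists_forall_dvdCompOnce (fun i => (l.get i).1)
    (fun i => (m'.get (Fin.cast hlen i)).1) (fun i => (hl _ (l.get_mem i)).2.1)
    (fun i => (hl _ (l.get_mem i)).1)
    (fun i j hij => by
      have := List.nodup_iff_injective_get.1 hnodup
        (a₁ := Fin.cast (by simp) i) (a₂ := Fin.cast (by simp) j) (by simpa using hij)
      simpa [Fin.ext_iff] using this)
    (fun i => (hget i i.2 (hlen ▸ i.2)).2) (fun i => (hget i i.2 (hlen ▸ i.2)).1.1)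
  have hrel' : Multiset.Rel (fun a b : K[X] × Multiset ℕ =>
      (a.1.natDegree = b.1.natDegree ∧ a.2 = b.2) ∧ (Irreducible b.1) ∧
        DvdCompOnce p a.1 b.1 ∧ Irreducible a.1 ∧ ∀ h ∈ a.2, 0 < h) l m := by
    rw [← Multiset.coe_eq_coe.2 hm']
    refine List.Forall₂.multisetRel (List.forall₂_iff_get.2 ⟨hlen, fun i h1 h2 => ?_⟩)
    exact ⟨(hget i h1 h2).1, (hget i h1 h2).2, hp ⟨i, h1⟩, (hl _ (l.get_mem _)).2.1,
      (hl _ (l.get_mem _)).2.2.2⟩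
  obtain ⟨e, he⟩ := exists_equiv_aeval hXc hYd p (by
    rw [hc, hd, ← Multiset.sum_coe, ← Multiset.sum_coe, ← Multiset.map_coe, ← Multiset.map_coe]
    refine Multiset.rel_bind ?_ hrel'
    rintro ⟨f, μ⟩ ⟨g, ν⟩ ⟨⟨hdeg, hμν⟩, hg, hdvd, hf, hpos⟩
    dsimp only at hμν
    subst hμν
    rw [Multiset.rel_map]
    exact Multiset.rel_refl_of_refl_on fun h hh => ⟨rfl, hpos h hh, hf, hg, hdeg, hdvd⟩)
  have hmat : LinearMap.toMatrix' e.toLinearMap * aeval X p =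
      Y * LinearMap.toMatrix' e.toLinearMap := by
    apply Matrix.toLin'.injective
    have haeval : Matrix.toLin' (aeval X p) = aeval (Matrix.toLin' X) p :=
      (aeval_algHom_apply (Matrix.toLinAlgEquiv' (R := K)).toAlgHom X p).symm
    refine LinearMap.ext fun v => ?_
    rw [Matrix.toLin'_mul, Matrix.toLin'_mul, Matrix.toLin'_toMatrix', haeval]
    exact he v
  refine ⟨p, ⟨LinearMap.toMatrix' e.toLinearMap, LinearMap.toMatrix' e.symm.toLinearMap, ?_, ?_⟩,
    hmat⟩
  · rw [← LinearMap.toMatrix'_comp]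
    simp
  · rw [← LinearMap.toMatrix'_comp]
    simp

theorem exists_conj_mem_centralizer {K : Type*} [Field K] [Finite K] {n : ℕ}
    {X Y : Matrix (Fin n) (Fin n) K} {T : Multiset (ℕ × Multiset ℕ)}
    (hX : HasClassType X T) (hY : HasClassType Y T) :
    ∃ P : (Matrix (Fin n) (Fin n) K)ˣ, ∀ A, Commute A X →
      Commute ((P : Matrix (Fin n) (Fin n) K) * A * (↑P⁻¹ : Matrix (Fin n) (Fin n) K)) Y := by
  obtain ⟨p, P, hP⟩ := exists_units_mul_aeval_eq hX hY
  refine ⟨P, fun A hA => ?_⟩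
  have hcomm (q : K[X]) : Commute A (aeval X q) := by
    induction q using Polynomial.induction_on' with
    | add q r hq hr => simpa only [map_add] using hq.add_right hr
    | monomial k a =>
      rw [aeval_monomial]
      exact (Algebra.commute_algebraMap_right a A).mul_right (hA.pow_right k)
  have hYP : Y = P * aeval X p * (↑P⁻¹ : Matrix (Fin n) (Fin n) K) := by
    rw [hP, Units.mul_inv_cancel_right]
  rw [hYP, commute_iff_eq]
  simp only [mul_assoc, Units.inv_mul_cancel_left]
  rw [← mul_assoc A, (hcomm p).eq, mul_assoc]

/-- Let `X` and `Y` be `n × n` matrices over the finite field `F_q` having the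
same class type.  Then the centralizers of `X` and of `Y` in `Mat_n(F_q)` are
conjugate: there is `g ∈ GL_n(F_q)` with `g⁻¹ · Cent(X) · g = Cent(Y)`. -/
theorem stmt5 {K : Type*} [Field K] [Fintype K] {n : ℕ}
    (X Y : Matrix (Fin n) (Fin n) K) (T : Multiset (ℕ × Multiset ℕ))
    (hX : HasClassType X T) (hY : HasClassType Y T) :
    ∃ g : (Matrix (Fin n) (Fin n) K)ˣ,
      (fun A => (↑g⁻¹ : Matrix (Fin n) (Fin n) K) * A * (↑g : Matrix (Fin n) (Fin n) K)) ''
          {A : Matrix (Fin n) (Fin n) K | Commute A X} =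
        {A : Matrix (Fin n) (Fin n) K | Commute A Y} := by
  classical
  obtain ⟨P, hP⟩ := exists_conj_mem_centralizer hX hY
  obtain ⟨Q, hQ⟩ := exists_conj_mem_centralizer hY hX
  have conj_injective (U : (Matrix (Fin n) (Fin n) K)ˣ) : Function.Injective fun A =>
      (U : Matrix (Fin n) (Fin n) K) * A * (↑U⁻¹ : Matrix (Fin n) (Fin n) K) := fun A B h =>
    U.isUnit.mul_left_cancel (U⁻¹.isUnit.mul_right_cancel h)
  refine ⟨P⁻¹, ?_⟩
  rw [inv_inv]
  refine Set.eq_of_subset_of_ncard_le ?_ ?_ (Set.toFinite _)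
  · rintro _ ⟨A, hA, rfl⟩
    exact hP A hA
  · rw [Set.ncard_image_of_injective _ (conj_injective P)]
    exact Set.ncard_le_ncard_of_injOn _ (fun A hA => hQ A hA) (conj_injective Q).injOn
      (Set.toFinite _)
end
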